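/- arXiv:math/9712251 — 2 statements merged into one kernel-verified Lean document; each statement's English description precedes it below -/
import Mathlib

section
/- Let X⁺ = {(z, w) ∈ ℂ² : (z − w)(z − 2w)(z − 3w)(z − 4w) ≠ 0} and X⁻ = {(z, w) ∈ ℂ² : (z − w̄)(z − 2w̄)(z − 3w)(z − 4w) ≠ 0}, each with the subspace topology from ℂ². Then X⁺ and X⁻ are not homotopy equivalent. -/
/-- The complement of Ziegler's complex arrangement `A⁺ = A(1234)` in `ℂ²`. -/
def zieglerPlus : Set (ℂ × ℂ) :=
  {p : ℂ × ℂ | (p.1 - p.2) * (p.1 - 2 * p.2) * (p.1 - 3 * p.2) * (p.1 - 4 * p.2) ≠ 0}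

/-- The complement of Ziegler's non-complex arrangement `A⁻ = A(2134)` in `ℂ² ≅ ℝ⁴`. -/
def zieglerMinus : Set (ℂ × ℂ) :=
  {p : ℂ × ℂ | (p.1 - (starRingEnd ℂ) p.2) * (p.1 - 2 * (starRingEnd ℂ) p.2) *
    (p.1 - 3 * p.2) * (p.1 - 4 * p.2) ≠ 0}


namespace Zieg

open Complex Set

/-- `h` has a continuous logarithm along `ℝ` with period jump `2πi n`. -/
def W (h : ℝ → ℂ) (n : ℤ) : Prop :=
  ∃ L : ℝ → ℂ, Continuous L ∧ (∀ t, exp (L t) = h t) ∧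
    ∀ t, L (t + 2 * Real.pi) = L t + n * (2 * Real.pi * I)

theorem int_const {X : Type*} [TopologicalSpace X] {S : Set X} (hS : IsPreconnected S)
    {D : X → ℂ} (hD : ContinuousOn D S) (h1 : ∀ x ∈ S, exp (D x) = 1) :
    ∃ n : ℤ, ∀ x ∈ S, D x = n * (2 * Real.pi * I) := by
  rcases S.eq_empty_or_nonempty with rfl | ⟨x0, hx0⟩
  · exact ⟨0, by simp⟩
  obtain ⟨n, hn⟩ := Complex.exp_eq_one_iff.1 (h1 x0 hx0)
  refine ⟨n, fun x hx => ?_⟩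
  have hc : ContinuousOn (fun x => (D x).im / (2 * Real.pi)) S :=
    (Complex.continuous_im.comp_continuousOn hD).div_const _
  have hpi := Real.pi_pos
  have key : ∀ (x : X) (m : ℤ), D x = m * (2 * Real.pi * I) → (D x).im / (2 * Real.pi) = m := by
    intro x m hm
    rw [hm]
    simp
  have hd : IsDiscrete (range ((↑) : ℤ → ℝ)) :=
    Int.isClosedEmbedding_coe_real.isEmbedding.isInducing.isDiscrete_range
  have := hS.constant_of_mapsTo (T := range ((↑) : ℤ → ℝ)) hd hc (by
    intro y hy
    obtain ⟨m, hm⟩ := Complex.exp_eq_one_iff.1 (h1 y hy)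
    exact ⟨m, (key y m hm).symm⟩) hx hx0
  obtain ⟨m, hm⟩ := Complex.exp_eq_one_iff.1 (h1 x hx)
  rw [key x m hm, key x0 n hn] at this
  have hmn : m = n := by exact_mod_cast this
  rw [hm, hmn]

theorem exists_log {A : Type*} [TopologicalSpace A] [SimplyConnectedSpace A]
    [LocallyPathConnectedSpace A] {u : A → ℂ} (hu : Continuous u) (h0 : ∀ a, u a ≠ 0) :
    ∃ L : A → ℂ, Continuous L ∧ ∀ a, exp (L a) = u a := by
  obtain ⟨a0⟩ : Nonempty A := inferInstance
  obtain ⟨F, ⟨-, hF⟩, -⟩ := isCoveringMapOn_exp.existsUnique_continuousMap_lifts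
    ⟨u, hu⟩ (a₀ := a0) (exp_log (h0 a0)) h0
  exact ⟨F, F.continuous, fun a => congrFun hF a⟩

theorem W.unique {h : ℝ → ℂ} {n m : ℤ} (h1 : W h n) (h2 : W h m) : n = m := by
  obtain ⟨L, hL, e1, p1⟩ := h1
  obtain ⟨M, hM, e2, p2⟩ := h2
  obtain ⟨k, hk⟩ := int_const (S := univ) (D := fun t => L t - M t) isPreconnected_univ
    (by fun_prop) (fun t _ => by
      rw [exp_sub, e1, e2, div_self]; rw [← e1]; exact exp_ne_zero _)
  have a := hk 0 trivial
  have b := hk (0 + 2 * Real.pi) trivial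
  simp only [p1, p2] at a b
  have : (n : ℂ) * (2 * Real.pi * I) = m * (2 * Real.pi * I) := by linear_combination b - a
  have := mul_right_cancel₀ two_pi_I_ne_zero this
  exact_mod_cast this

theorem W.mul {h k : ℝ → ℂ} {n m : ℤ} (h1 : W h n) (h2 : W k m) :
    W (fun t => h t * k t) (n + m) := by
  obtain ⟨L, hL, e1, p1⟩ := h1
  obtain ⟨M, hM, e2, p2⟩ := h2
  refine ⟨fun t => L t + M t, by fun_prop, fun t => by rw [exp_add, e1, e2], fun t => ?_⟩
  simp only [p1, p2]; push_cast; ring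

theorem W.zpow {h : ℝ → ℂ} {n : ℤ} (h1 : W h n) (m : ℤ) :
    W (fun t => h t ^ m) (m * n) := by
  obtain ⟨L, hL, e1, p1⟩ := h1
  refine ⟨fun t => m * L t, by fun_prop, fun t => by rw [exp_int_mul, e1], fun t => ?_⟩
  simp only [p1]; push_cast; ring

theorem W.div {h k : ℝ → ℂ} {n m : ℤ} (h1 : W h n) (h2 : W k m) :
    W (fun t => h t / k t) (n - m) := by
  have := h1.mul (h2.zpow (-1))
  simpa [div_eq_mul_inv, sub_eq_add_neg] using this

theorem W.conj {h : ℝ → ℂ} {n : ℤ} (h1 : W h n) :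
    W (fun t => (starRingEnd ℂ) (h t)) (-n) := by
  obtain ⟨L, hL, e1, p1⟩ := h1
  refine ⟨fun t => (starRingEnd ℂ) (L t), Complex.continuous_conj.comp hL,
    fun t => by rw [exp_conj, e1], fun t => ?_⟩
  have h2 : (starRingEnd ℂ) (2 : ℂ) = 2 := Complex.conj_ofNat 2
  simp [p1, h2]

theorem W.of_log {h : ℝ → ℂ} (L : ℝ → ℂ) (hL : Continuous L) (e : ∀ t, exp (L t) = h t)
    (p : ∀ t, L (t + 2 * Real.pi) = L t) : W h 0 := ⟨L, hL, e, by simpa using p⟩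

theorem W.of_slit {h : ℝ → ℂ} (hc : Continuous h) (hs : ∀ t, h t ∈ slitPlane)
    (p : ∀ t, h (t + 2 * Real.pi) = h t) : W h 0 :=
  W.of_log (fun t => log (h t)) (hc.clog hs)
    (fun t => exp_log (slitPlane_ne_zero (hs t))) (fun t => by simp only [p])

theorem W.const {c : ℂ} (hc : c ≠ 0) : W (fun _ => c) 0 :=
  W.of_log (fun _ => log c) (by fun_prop) (fun _ => exp_log hc) (fun _ => rfl)

theorem W.cont {h : ℝ → ℂ} {n : ℤ} (h1 : W h n) : Continuous h := by
  obtain ⟨L, hL, e1, p1⟩ := h1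
  have : h = fun t => exp (L t) := funext fun t => (e1 t).symm
  rw [this]; fun_prop

theorem W.ne {h : ℝ → ℂ} {n : ℤ} (h1 : W h n) (t : ℝ) : h t ≠ 0 := by
  obtain ⟨L, hL, e1, p1⟩ := h1
  rw [← e1]; exact exp_ne_zero _

theorem W.per {h : ℝ → ℂ} {n : ℤ} (h1 : W h n) (t : ℝ) : h (t + 2 * Real.pi) = h t := by
  obtain ⟨L, hL, e1, p1⟩ := h1
  rw [← e1, ← e1, p1, exp_add, exp_int_mul_two_pi_mul_I, mul_one]

theorem W.lin {h : ℝ → ℂ} {n : ℤ} (h1 : W h n) {a b : ℝ} (hb : 0 ≤ b) (hab : b < a) :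
    W (fun t => a * h t - b * (starRingEnd ℂ) (h t)) n := by
  have hc := h1.cont
  have hne := h1.ne
  have hper := h1.per
  have : W (fun t => a - b * ((starRingEnd ℂ) (h t) / h t)) 0 := by
    refine W.of_slit ?_ ?_ ?_
    · exact continuous_const.sub (continuous_const.mul
        ((Complex.continuous_conj.comp hc).div hc hne))
    · intro t
      left
      have h2 : ((starRingEnd ℂ) (h t) / h t).re ≤ 1 := by
        refine (re_le_norm _).trans ?_
        rw [norm_div, norm_conj, div_self (norm_ne_zero_iff.2 (hne t))]
      rw [sub_re, re_ofReal_mul, ofReal_re]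
      nlinarith
    · intro t; simp only [hper]
  have h3 := h1.mul this
  rw [add_zero] at h3
  convert h3 using 2 with t
  have := hne t
  field_simp

theorem W.lin' {h : ℝ → ℂ} {n : ℤ} (h1 : W h n) {a b : ℝ} (ha : 0 ≤ a) (hab : a < b) :
    W (fun t => a * h t - b * (starRingEnd ℂ) (h t)) (-n) := by
  have h2 := (h1.conj.lin ha hab).mul (W.const (c := -1) (by norm_num))
  rw [add_zero] at h2
  convert h2 using 2 with t
  simp

theorem W.hom {H : ℝ × ℝ → ℂ} (hc : Continuous H) (h0 : ∀ p, H p ≠ 0)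
    (hp : ∀ r t, H (r, t + 2 * Real.pi) = H (r, t)) :
    ∃ n : ℤ, ∀ r, W (fun t => H (r, t)) n := by
  obtain ⟨L, hL, e⟩ := exists_log hc h0
  obtain ⟨n, hn⟩ := int_const (S := univ) (D := fun p : ℝ × ℝ => L (p.1, p.2 + 2 * Real.pi) - L p)
    isPreconnected_univ (by fun_prop) (fun p _ => by
      rw [exp_sub, e, e, hp, div_self (h0 _)])
  refine ⟨n, fun r => ⟨fun t => L (r, t), by fun_prop, fun t => e _, fun t => ?_⟩⟩
  have := hn (r, t) trivial
  simp only at this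
  linear_combination this

theorem W.circle {c : ℂ} (hc : c ≠ 0) : W (fun t => c * exp (t * I)) 1 := by
  refine ⟨fun t => log c + t * I, by fun_prop, fun t => by rw [exp_add, exp_log hc], fun t => ?_⟩
  push_cast; ring

/-- A map of the plane at bounded distance from the identity has a zero. -/
theorem exists_zero {F : ℂ → ℂ} (hF : Continuous F) {C : ℝ} (hC : ∀ z, ‖F z - z‖ ≤ C) :
    ∃ z, F z = 0 := by
  by_contra! h
  have hC0 : 0 ≤ C := (norm_nonneg _).trans (hC 0)
  set R : ℝ := C + 1 with hR
  have hR0 : (R : ℂ) ≠ 0 := by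
    rw [Ne, ofReal_eq_zero]; positivity
  obtain ⟨n, hn⟩ := W.hom (H := fun p : ℝ × ℝ => F (p.1 * exp (p.2 * I))) (by fun_prop)
    (fun p => h _) (fun r t => by
      simp only
      rw [show ((t + 2 * Real.pi : ℝ) : ℂ) * I = t * I + 2 * Real.pi * I by push_cast; ring,
        exp_periodic])
  have h1 : n = 0 := by
    refine (hn 0).unique ?_
    simpa using W.const (h 0)
  have h2 : n = 1 := by
    have hk := W.circle hR0
    have : W (fun t => F (R * exp (t * I)) / (R * exp (t * I))) 0 := by
      refine W.of_slit (by
        refine Continuous.div (by fun_prop) (by fun_prop) hk.ne) (fun t => ?_) (fun t => ?_)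
      · left
        have hne := hk.ne t
        set w := (R * exp (t * I) : ℂ) with hw
        have hnw : ‖w‖ = R := by
          rw [hw, norm_mul, norm_exp_ofReal_mul_I, norm_real, mul_one, Real.norm_of_nonneg]
          positivity
        have e1 : F w / w = 1 + (F w - w) / w := by field_simp; ring
        have e2 : ‖(F w - w) / w‖ < 1 := by
          rw [norm_div, hnw, div_lt_one (by positivity)]
          exact (hC w).trans_lt (by rw [hR]; linarith)
        have e3 := (abs_lt.1 ((abs_re_le_norm _).trans_lt e2)).1
        rw [e1, add_re, one_re]; linarith
      · have := hk.per t
        simp only [this]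
    have h3 := this.mul hk
    rw [zero_add] at h3
    refine (hn R).unique ?_
    convert h3 using 2 with t
    have := hk.ne t
    field_simp
  omega

theorem bdd_of_per {P : ℝ × ℝ → ℝ} (hP : Continuous P)
    (h1 : ∀ s t, P (s + 2 * Real.pi, t) = P (s, t))
    (h2 : ∀ s t, P (s, t + 2 * Real.pi) = P (s, t)) : ∃ C, ∀ p, |P p| ≤ C := by
  have hK : IsCompact (Icc (0 : ℝ) (2 * Real.pi) ×ˢ Icc (0 : ℝ) (2 * Real.pi)) :=
    isCompact_Icc.prod isCompact_Icc
  obtain ⟨C, hC⟩ := hK.exists_bound_of_continuousOn hP.continuousOn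
  refine ⟨C, fun ⟨s, t⟩ => ?_⟩
  obtain ⟨s', hs', e1⟩ := Function.Periodic.exists_mem_Ico₀ (f := fun s => P (s, t))
    (fun s => h1 s t) Real.two_pi_pos s
  obtain ⟨t', ht', e2⟩ := Function.Periodic.exists_mem_Ico₀ (f := fun t => P (s', t))
    (fun t => h2 s' t) Real.two_pi_pos t
  rw [show P (s, t) = P (s', t) from e1, show P (s', t) = P (s', t') from e2]
  exact hC (s', t') ⟨Ico_subset_Icc_self hs', Ico_subset_Icc_self ht'⟩

theorem torus {T : ℝ × ℝ → ℂ} (hT : Continuous T) (h0 : ∀ p, T p ≠ 0) (h1 : ∀ p, T p ≠ 1)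
    (ps : ∀ s t, T (s + 2 * Real.pi, t) = T (s, t))
    (pt : ∀ s t, T (s, t + 2 * Real.pi) = T (s, t))
    {a b c d : ℤ} (ha : W (fun s => T (s, 0)) a) (hb : W (fun t => T (0, t)) b)
    (hc : W (fun s => T (s, 0) - 1) c) (hd : W (fun t => T (0, t) - 1) d) :
    a * d = b * c := by
  -- general facts on logs
  have gen : ∀ (u : ℝ × ℝ → ℂ), Continuous u → (∀ p, u p ≠ 0) →
      (∀ s t, u (s + 2 * Real.pi, t) = u (s, t)) → (∀ s t, u (s, t + 2 * Real.pi) = u (s, t)) →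
      ∀ a b : ℤ, W (fun s => u (s, 0)) a → W (fun t => u (0, t)) b →
      ∃ A : ℝ × ℝ → ℝ, Continuous A ∧ (∀ p, ∃ r : ℝ, u p = exp (r + A p * I)) ∧
        ∃ C, ∀ p, |A p - (a * p.1 + b * p.2)| ≤ C := by
    intro u hu h0 ps pt a b ha hb
    obtain ⟨L, hL, e⟩ := exists_log hu h0
    obtain ⟨n, hn⟩ := int_const (S := univ)
      (D := fun p : ℝ × ℝ => L (p.1, p.2 + 2 * Real.pi) - L p)
      isPreconnected_univ (by fun_prop) (fun p _ => by
        rw [exp_sub, e, e, pt, div_self (h0 _)])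
    obtain ⟨m, hm⟩ := int_const (S := univ)
      (D := fun p : ℝ × ℝ => L (p.1 + 2 * Real.pi, p.2) - L p)
      isPreconnected_univ (by fun_prop) (fun p _ => by
        rw [exp_sub, e, e, ps, div_self (h0 _)])
    have hnb : n = b := W.unique ⟨fun t => L (0, t), by fun_prop, fun t => e _, fun t => by
      have := hn (0, t) trivial
      simp only at this
      linear_combination this⟩ hb
    have hma : m = a := W.unique ⟨fun t => L (t, 0), by fun_prop, fun t => e _, fun t => by
      have := hm (t, 0) trivial
      simp only at this
      linear_combination this⟩ ha
    subst hnb hma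
    refine ⟨fun p => (L p).im, by fun_prop, fun p => ⟨(L p).re, ?_⟩, ?_⟩
    · rw [re_add_im, e]
    · refine bdd_of_per (P := fun p : ℝ × ℝ => (L p).im - (m * p.1 + n * p.2)) (by fun_prop)
        (fun s t => ?_) (fun s t => ?_)
      · have := congrArg im (hm (s, t) trivial)
        simp at this
        simp only
        linear_combination this
      · have := congrArg im (hn (s, t) trivial)
        simp at this
        simp only
        linear_combination this
  obtain ⟨A, hA, eA, CA, hCA⟩ := gen T hT h0 ps pt a b ha hb
  obtain ⟨B, hB, eB, CB, hCB⟩ := gen (fun p => T p - 1) (by fun_prop)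
    (fun p => sub_ne_zero.2 (h1 p)) (fun s t => by rw [ps]) (fun s t => by rw [pt]) c d hc hd
  by_contra hne
  have hΔ : ((a : ℝ) * d - b * c) ≠ 0 := by
    intro h; apply hne; have : (a : ℝ) * d = b * c := by linarith
    exact_mod_cast this
  set Δ : ℝ := (a : ℝ) * d - b * c with hΔd
  let q : ℂ → ℝ × ℝ := fun z => ((d * z.re - b * z.im) / Δ, (-c * z.re + a * z.im) / Δ)
  have hq : Continuous q := by fun_prop
  obtain ⟨z, hz⟩ := exists_zero (F := fun z => (A (q z) - Real.pi / 2 : ℝ) + (B (q z) : ℝ) * I)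
    (by fun_prop) (C := (CA + Real.pi / 2) + CB) (fun z => by
      have e1 : a * (q z).1 + b * (q z).2 = z.re := by
        simp only [q]; field_simp; rw [hΔd]; ring
      have e2 : c * (q z).1 + d * (q z).2 = z.im := by
        simp only [q]; field_simp; rw [hΔd]; ring
      have f1 := hCA (q z)
      have f2 := hCB (q z)
      rw [e1] at f1
      rw [e2] at f2
      refine (norm_le_abs_re_add_abs_im _).trans ?_
      refine add_le_add ?_ ?_
      · simp
        have := Real.pi_pos
        rw [abs_le] at f1 ⊢
        constructor <;> linarith [f1.1, f1.2]
      · simpa using f2)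
  have z1 := congrArg re hz
  have z2 := congrArg im hz
  simp at z1 z2
  obtain ⟨r, hr⟩ := eA (q z)
  obtain ⟨r', hr'⟩ := eB (q z)
  have z1' : A (q z) = Real.pi / 2 := by linarith
  rw [z1', exp_add] at hr
  simp only [z2] at hr'
  rw [hr] at hr'
  have := congrArg re hr'
  have hh : exp (((Real.pi / 2 : ℝ) : ℂ) * I) = I := by push_cast; exact exp_pi_div_two_mul_I
  rw [hh] at this
  simp [exp_re] at this
  have := Real.exp_pos r'
  linarith


/-- The bad real parts. -/
def badSet : Set ℝ := {-1, -1/2, -1/3}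

/-- The slit regions. -/
def U (σ : ℝ) : Set (ℂ × ℂ) := {p | p.2.re ∉ badSet ∨ 0 < σ * p.2.im}

theorem isOpen_U (σ : ℝ) : IsOpen (U σ) := by
  have hb : IsClosed badSet := by
    unfold badSet; exact (Set.toFinite _).isClosed
  exact (hb.isOpen_compl.preimage (by fun_prop : Continuous fun p : ℂ × ℂ => p.2.re)).union
    (isOpen_lt continuous_const (by fun_prop : Continuous fun p : ℂ × ℂ => σ * p.2.im))

theorem homotopic_line {X E : Type*} [TopologicalSpace X] [AddCommGroup E] [Module ℝ E]
    [TopologicalSpace E] [IsTopologicalAddGroup E] [ContinuousSMul ℝ E] {S : Set E}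
    (f g : C(X, S)) (h : ∀ x, ∀ t ∈ Icc (0 : ℝ) 1, (f x : E) + t • ((g x : E) - f x) ∈ S) :
    f.Homotopic g := by
  refine ⟨{ toFun := fun q => ⟨(f q.2 : E) + (q.1 : ℝ) • ((g q.2 : E) - f q.2), h _ _ q.1.2⟩
            continuous_toFun := ?_
            map_zero_left := ?_
            map_one_left := ?_ }⟩
  · refine Continuous.subtype_mk ?_ _
    fun_prop
  · intro x; ext; simp
  · intro x; ext; simp

theorem contractible_U {σ : ℝ} (hσ : σ ≠ 0) : ContractibleSpace (U σ) := by
  rw [contractible_iff_id_nullhomotopic]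
  have hs : 0 < σ * σ := mul_self_pos.2 hσ
  obtain ⟨ρ, hρc, hρ0, hρ⟩ : ∃ ρ : ℝ → ℝ, Continuous ρ ∧ (∀ y, 0 ≤ ρ y) ∧
      ∀ y, 0 < σ * (y + σ * ρ y) := by
    refine ⟨fun y => 1 + |σ * y| / (σ * σ), by fun_prop, fun y => by positivity, fun y => ?_⟩
    have : 0 ≤ |σ * y| + σ * y := by linarith [neg_abs_le (σ * y)]
    have e : σ * (y + σ * (1 + |σ * y| / (σ * σ))) = σ * σ + (|σ * y| + σ * y) := by
      field_simp; ring
    rw [e]; linarith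
  let g : C(U σ, U σ) := ⟨fun p => ⟨(p.1.1, p.1.2 + ((σ * ρ p.1.2.im : ℝ) : ℂ) * I), by
    right
    simpa using hρ p.1.2.im⟩, by
      refine Continuous.subtype_mk ?_ _
      fun_prop⟩
  have hg : ∀ p, 0 < σ * (g p).1.2.im := by
    intro p
    simpa [g] using hρ p.1.2.im
  let c : U σ := ⟨(0, (σ : ℂ) * I), by right; simpa using hs⟩
  refine ⟨c, ContinuousMap.Homotopic.trans (homotopic_line _ g ?_) (homotopic_line g _ ?_)⟩
  · rintro ⟨p, hp⟩ t ⟨ht0, ht1⟩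
    have hpos : 0 ≤ t * (σ * σ * ρ p.2.im) :=
      mul_nonneg ht0 (mul_nonneg hs.le (hρ0 _))
    rcases hp with hp | hp
    · left
      simpa [g] using hp
    · right
      simp [g]
      nlinarith
  · intro x t ⟨ht0, ht1⟩
    right
    have := hg x
    have e : σ * ((g x).1 + t • (((ContinuousMap.const (U σ) c) x : ℂ × ℂ) - (g x).1)).2.im =
      (1 - t) * (σ * (g x).1.2.im) + t * (σ * σ) := by
      simp [c]; ring
    rw [e]
    rcases ht0.eq_or_lt with rfl | h
    · simpa using this
    · have : 0 ≤ (1 - t) * (σ * (g x).1.2.im) := mul_nonneg (by linarith) this.le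
      have : 0 < t * (σ * σ) := by positivity
      linarith

theorem log_U {σ : ℝ} (hσ : σ ≠ 0) {h : ℂ × ℂ → ℂ} (hc : ContinuousOn h (U σ))
    (h0 : ∀ p ∈ U σ, h p ≠ 0) :
    ∃ L : ℂ × ℂ → ℂ, ContinuousOn L (U σ) ∧ ∀ p ∈ U σ, exp (L p) = h p := by
  have := contractible_U hσ
  have hsc : SimplyConnectedSpace (U σ) := inferInstance
  obtain ⟨L, hL, e⟩ := Complex.exists_continuousOn_eqOn_exp_comp (U := U σ)
    (show IsSimplyConnected (U σ) from hsc)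
    (isOpen_U σ) hc (by rintro ⟨p, hp, e⟩; exact h0 p hp e)
  exact ⟨L, hL, e⟩

/-- translation by the period -/
noncomputable def tr (p : ℂ × ℂ) : ℂ × ℂ := (p.1 + 2 * Real.pi * I, p.2)

theorem tr_mem {σ : ℝ} {p : ℂ × ℂ} (hp : p ∈ U σ) : tr p ∈ U σ := hp

theorem preconn_U {σ : ℝ} (hσ : σ ≠ 0) : IsPreconnected (U σ) := by
  have := contractible_U hσ
  have : PreconnectedSpace (U σ) := inferInstance
  exact isPreconnected_iff_preconnectedSpace.2 this

/-- The common base point. -/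
theorem base_mem (σ : ℝ) : ((0, 0) : ℂ × ℂ) ∈ U σ := by
  left
  simp [badSet]
  norm_num

theorem K0 {h : ℂ × ℂ → ℂ} (hc : ContinuousOn h (U 1 ∪ U (-1)))
    (h0 : ∀ p ∈ U 1 ∪ U (-1), h p ≠ 0) (hp : ∀ p ∈ U 1 ∪ U (-1), h (tr p) = h p) :
    ∃ x : ℤ, ∀ σ : ℝ, (σ = 1 ∨ σ = -1) → ∃ L : ℂ × ℂ → ℂ, ContinuousOn L (U σ) ∧
      (∀ p ∈ U σ, exp (L p) = h p) ∧ ∀ p ∈ U σ, L (tr p) = L p + x * (2 * Real.pi * I) := by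
  have key : ∀ σ : ℝ, (σ = 1 ∨ σ = -1) → ∃ x : ℤ, ∃ L : ℂ × ℂ → ℂ, ContinuousOn L (U σ) ∧
      (∀ p ∈ U σ, exp (L p) = h p) ∧ ∀ p ∈ U σ, L (tr p) = L p + x * (2 * Real.pi * I) := by
    intro σ hσ
    have hsub : U σ ⊆ U 1 ∪ U (-1) := by
      rcases hσ with rfl | rfl
      · exact subset_union_left
      · exact subset_union_right
    have hσ0 : σ ≠ 0 := by rcases hσ with rfl | rfl <;> norm_num
    obtain ⟨L, hL, e⟩ := log_U hσ0 (hc.mono hsub) (fun p hp => h0 p (hsub hp))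
    have htr : Continuous tr := by unfold tr; fun_prop
    obtain ⟨x, hx⟩ := int_const (D := fun p => L (tr p) - L p) (preconn_U hσ0)
      ((hL.comp htr.continuousOn (fun p hp => tr_mem hp)).sub hL) (fun p hq => by
        rw [exp_sub, e _ (tr_mem hq), e _ hq, hp _ (hsub hq), div_self (h0 _ (hsub hq))])
    refine ⟨x, L, hL, e, fun p hp => ?_⟩
    have := hx p hp
    linear_combination this
  obtain ⟨x, L, hL, e, p1⟩ := key 1 (Or.inl rfl)
  obtain ⟨y, M, hM, e', p2⟩ := key (-1) (Or.inr rfl)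
  have hW : ∀ (σ : ℝ) (x : ℤ) (L : ℂ × ℂ → ℂ), ContinuousOn L (U σ) →
      (∀ p ∈ U σ, exp (L p) = h p) → (∀ p ∈ U σ, L (tr p) = L p + x * (2 * Real.pi * I)) →
      W (fun t => h (t * I, 0)) x := by
    intro σ x L hL e p1
    have hm : ∀ t : ℝ, ((t * I, 0) : ℂ × ℂ) ∈ U σ := fun t => base_mem σ
    refine ⟨fun t => L (t * I, 0), hL.comp_continuous (by fun_prop) hm, fun t => e _ (hm t),
      fun t => ?_⟩
    rw [← p1 _ (hm t), tr]
    have : ((t + 2 * Real.pi : ℝ) : ℂ) * I = t * I + 2 * Real.pi * I := by push_cast; ring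
    simp only [this]
  have hxy : x = y := (hW _ x L hL e p1).unique (hW _ y M hM e' p2)
  subst hxy
  refine ⟨x, fun σ hσ => ?_⟩
  rcases hσ with rfl | rfl
  · exact ⟨L, hL, e, p1⟩
  · exact ⟨M, hM, e', p2⟩

theorem strip {L M h : ℂ × ℂ → ℂ} (hL : ContinuousOn L (U 1)) (hM : ContinuousOn M (U (-1)))
    (e1 : ∀ p ∈ U 1, exp (L p) = h p) (e2 : ∀ p ∈ U (-1), exp (M p) = h p)
    {J : Set ℝ} (hJ : Convex ℝ J) (hb : ∀ x ∈ J, x ∉ badSet) :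
    ∃ n : ℤ, ∀ p : ℂ × ℂ, p.2.re ∈ J → L p - M p = n * (2 * Real.pi * I) := by
  have hS : Convex ℝ {p : ℂ × ℂ | p.2.re ∈ J} :=
    hJ.linear_preimage (Complex.reLm ∘ₗ LinearMap.snd ℝ ℂ ℂ)
  have s1 : ∀ σ, {p : ℂ × ℂ | p.2.re ∈ J} ⊆ U σ := fun σ p hp => Or.inl (hb _ hp)
  obtain ⟨n, hn⟩ := int_const hS.isPreconnected ((hL.mono (s1 1)).sub (hM.mono (s1 (-1))))
    (fun p hp => by
      rw [Pi.sub_apply, exp_sub, e1 p (s1 _ hp), e2 p (s1 _ hp), div_self]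
      rw [← e1 p (s1 _ hp)]; exact exp_ne_zero _)
  exact ⟨n, hn⟩

/-- The four intervals. -/
def Jv : Fin 4 → Set ℝ := ![Iio (-1), Ioo (-1) (-1/2), Ioo (-1/2) (-1/3), Ioi (-1/3)]

theorem Jv_convex (j : Fin 4) : Convex ℝ (Jv j) := by
  fin_cases j
  · exact convex_Iio _
  · exact convex_Ioo _ _
  · exact convex_Ioo _ _
  · exact convex_Ioi _

theorem Jv_good (j : Fin 4) (x : ℝ) (hx : x ∈ Jv j) : x ∉ badSet := by
  rintro (rfl | rfl | rfl) <;> fin_cases j <;> simp [Jv] at hx <;> linarith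

theorem Jv_cover (x : ℝ) (hx : x ∉ badSet) : ∃ j, x ∈ Jv j := by
  simp only [badSet, mem_insert_iff, mem_singleton_iff, not_or] at hx
  obtain ⟨h1, h2, h3⟩ := hx
  rcases lt_or_gt_of_ne h1 with h | h
  · exact ⟨0, h⟩
  rcases lt_or_gt_of_ne h2 with h' | h'
  · exact ⟨1, h, h'⟩
  rcases lt_or_gt_of_ne h3 with h'' | h''
  · exact ⟨2, h', h''⟩
  · exact ⟨3, h''⟩

theorem K2 {h : Fin 4 → ℂ × ℂ → ℂ} (hc : ∀ i, ContinuousOn (h i) (U 1 ∪ U (-1)))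
    (h0 : ∀ i, ∀ p ∈ U 1 ∪ U (-1), h i p ≠ 0) (hp : ∀ i, ∀ p ∈ U 1 ∪ U (-1), h i (tr p) = h i p)
    (hw : ∀ i, W (fun t => h i (t * I, 0)) 0) :
    ∃ m : Fin 4 → ℤ, m ≠ 0 ∧ ∃ L : ℂ × ℂ → ℂ, ContinuousOn L (U 1 ∪ U (-1)) ∧
      (∀ p ∈ U 1 ∪ U (-1), exp (L p) = ∏ i, h i p ^ m i) ∧
      ∀ p ∈ U 1 ∪ U (-1), L (tr p) = L p := by
  have hk := fun i => K0 (hc i) (h0 i) (hp i)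
  choose x hx using hk
  have hL := fun i => hx i 1 (Or.inl rfl)
  have hM := fun i => hx i (-1) (Or.inr rfl)
  choose L cL eL pL using hL
  choose M cM eM pM using hM
  have hx0 : ∀ i, x i = 0 := by
    intro i
    refine W.unique ?_ (hw i)
    have hm : ∀ t : ℝ, ((t * I, 0) : ℂ × ℂ) ∈ U 1 := fun t => base_mem 1
    refine ⟨fun t => L i (t * I, 0), (cL i).comp_continuous (by fun_prop) hm,
      fun t => eL i _ (hm t), fun t => ?_⟩
    rw [← pL i _ (hm t), tr]
    have : ((t + 2 * Real.pi : ℝ) : ℂ) * I = t * I + 2 * Real.pi * I := by push_cast; ring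
    simp only [this]
  have hn := fun i j => strip (cL i) (cM i) (eL i) (eM i) (Jv_convex j) (Jv_good j)
  choose n hn using hn
  obtain ⟨m, hm0, hm, -⟩ := Int.Matrix.exists_ne_zero_int_vec_norm_le
    (Matrix.of fun (j : Fin 3) (i : Fin 4) => n i j.succ - n i 0) (by simp) (by simp)
  have hm' : ∀ j : Fin 4, ∑ i, m i * (n i j - n i 0) = 0 := by
    intro j
    refine Fin.cases (by simp) (fun j => ?_) j
    have := congrFun hm j
    simp only [Matrix.mulVec, dotProduct, Matrix.of_apply, Pi.zero_apply] at this
    rw [← this]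
    exact Finset.sum_congr rfl fun i _ => mul_comm _ _
  let LL : ℂ × ℂ → ℂ := fun p => ∑ i, m i * L i p
  let MM : ℂ × ℂ → ℂ := fun p => ∑ i, m i * (M i p + n i 0 * (2 * Real.pi * I))
  have cLL : ContinuousOn LL (U 1) := by
    refine continuousOn_finsetSum _ fun i _ => continuousOn_const.mul (cL i)
  have cMM : ContinuousOn MM (U (-1)) := by
    refine continuousOn_finsetSum _ fun i _ =>
      continuousOn_const.mul ((cM i).add continuousOn_const)
  have eLL : ∀ p ∈ U 1, exp (LL p) = ∏ i, h i p ^ m i := by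
    intro p hp
    simp only [LL, exp_sum]
    exact Finset.prod_congr rfl fun i _ => by rw [exp_int_mul, eL i p hp]
  have eMM : ∀ p ∈ U (-1), exp (MM p) = ∏ i, h i p ^ m i := by
    intro p hp
    simp only [MM, exp_sum]
    exact Finset.prod_congr rfl fun i _ => by
      rw [exp_int_mul, exp_add, eM i p hp, exp_int_mul_two_pi_mul_I, mul_one]
  have agree : ∀ p, p ∈ U 1 → p ∈ U (-1) → LL p = MM p := by
    intro p h1 h2
    have hb : p.2.re ∉ badSet := by
      rcases h1 with h1 | h1
      · exact h1
      rcases h2 with h2 | h2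
      · exact h2
      linarith
    obtain ⟨j, hj⟩ := Jv_cover _ hb
    rw [← sub_eq_zero]
    have : LL p - MM p = ((∑ i, m i * (n i j - n i 0) : ℤ) : ℂ) * (2 * Real.pi * I) := by
      simp only [LL, MM]
      rw [← Finset.sum_sub_distrib]
      push_cast
      rw [Finset.sum_mul]
      refine Finset.sum_congr rfl fun i _ => ?_
      have := hn i j p hj
      linear_combination (m i : ℂ) * this
    rw [this, hm' j]; simp
  classical
  let F : ℂ × ℂ → ℂ := fun p => if p ∈ U 1 then LL p else MM p
  have F1 : ∀ p ∈ U 1, F p = LL p := fun p hp => if_pos hp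
  have F2 : ∀ p ∈ U (-1), F p = MM p := by
    intro p hp
    by_cases h : p ∈ U 1
    · rw [F1 p h, agree p h hp]
    · exact if_neg h
  refine ⟨m, hm0, F, ?_, ?_, ?_⟩
  · exact (cLL.congr F1).union_of_isOpen (cMM.congr F2) (isOpen_U _) (isOpen_U _)
  · rintro p (hp | hp)
    · rw [F1 p hp, eLL p hp]
    · rw [F2 p hp, eMM p hp]
  · rintro p (hp | hp)
    · rw [F1 p hp, F1 _ (tr_mem hp)]
      simp only [LL]
      exact Finset.sum_congr rfl fun i _ => by rw [pL i p hp, hx0]; simp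
    · rw [F2 p hp, F2 _ (tr_mem hp)]
      simp only [MM]
      exact Finset.sum_congr rfl fun i _ => by rw [pM i p hp, hx0]; simp


/-- Parametrization of the complex complement. -/
noncomputable def Psi (p : ℂ × ℂ) : ℂ × ℂ := (exp p.1 * (1 + 4 * p.2), exp p.1 * p.2)

theorem continuous_Psi : Continuous Psi := by unfold Psi; fun_prop

theorem mem_V {p : ℂ × ℂ} :
    p ∈ U 1 ∪ U (-1) ↔ p.2 ≠ ((-1 : ℝ) : ℂ) ∧ p.2 ≠ ((-1/2 : ℝ) : ℂ) ∧ p.2 ≠ ((-1/3 : ℝ) : ℂ) := by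
  constructor
  · intro hp
    have : p.2.re ∉ badSet ∨ p.2.im ≠ 0 := by
      rcases hp with (h | h) | (h | h)
      · exact Or.inl h
      · right; intro h'; rw [h'] at h; simp at h
      · exact Or.inl h
      · right; intro h'; rw [h'] at h; simp at h
    refine ⟨?_, ?_, ?_⟩ <;> intro h <;> rw [h] at this <;> rw [ofReal_re, ofReal_im] at this <;>
      simp [badSet] at this
  · rintro ⟨h1, h2, h3⟩
    by_contra hcon
    rw [mem_union, not_or] at hcon
    obtain ⟨c1, c2⟩ := hcon
    simp only [U, mem_ofPred_eq, not_or, not_not, not_lt] at c1 c2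
    have him : p.2.im = 0 := by linarith [c1.2, c2.2]
    rcases c1.1 with h | h | h
    · exact h1 (Complex.ext (by simpa using h) (by simpa using him))
    · exact h2 (Complex.ext (by rw [ofReal_re]; exact h) (by rw [ofReal_im]; exact him))
    · exact h3 (Complex.ext (by rw [ofReal_re]; exact h) (by rw [ofReal_im]; exact him))

theorem Psi_mem {p : ℂ × ℂ} : Psi p ∈ zieglerPlus ↔ p ∈ U 1 ∪ U (-1) := by
  rw [mem_V]
  have hE := exp_ne_zero p.1
  have e : ((Psi p).1 - (Psi p).2) * ((Psi p).1 - 2 * (Psi p).2) * ((Psi p).1 - 3 * (Psi p).2) *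
      ((Psi p).1 - 4 * (Psi p).2)
      = 6 * exp p.1 ^ 4 * ((p.2 - ((-1 : ℝ) : ℂ)) * ((p.2 - ((-1/2 : ℝ) : ℂ)) *
        (p.2 - ((-1/3 : ℝ) : ℂ)))) := by
    simp only [Psi]; push_cast; ring
  simp only [zieglerPlus, mem_ofPred_eq]
  rw [e, mul_ne_zero_iff, mul_ne_zero_iff (b := _ * _), mul_ne_zero_iff (a := p.2 - _),
    sub_ne_zero, sub_ne_zero, sub_ne_zero]
  have : 6 * exp p.1 ^ 4 ≠ 0 := mul_ne_zero (by norm_num) (pow_ne_zero _ hE)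
  tauto

theorem Psi_tr (p : ℂ × ℂ) : Psi (tr p) = Psi p := by
  simp [Psi, tr, exp_add]

open Classical in
/-- Pullback of a function to the parameter space. -/
noncomputable def pb (u : zieglerPlus → ℂ) (p : ℂ × ℂ) : ℂ :=
  if h : Psi p ∈ zieglerPlus then u ⟨Psi p, h⟩ else 1

theorem pb_eq (u : zieglerPlus → ℂ) {p : ℂ × ℂ} (y : zieglerPlus) (h : Psi p = y) :
    pb u p = u y := by
  have h' : Psi p ∈ zieglerPlus := h ▸ y.2
  rw [pb, dif_pos h']
  congr 1
  exact Subtype.ext h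

theorem pb_cont {u : zieglerPlus → ℂ} (hu : Continuous u) :
    ContinuousOn (pb u) (U 1 ∪ U (-1)) := by
  rw [continuousOn_iff_continuous_domRestrict]
  have : (U 1 ∪ U (-1)).domRestrict (pb u)
      = fun p : ↥(U 1 ∪ U (-1)) => u ⟨Psi p, Psi_mem.2 p.2⟩ := by
    ext p
    exact pb_eq u ⟨Psi p, Psi_mem.2 p.2⟩ rfl
  rw [this]
  exact hu.comp (Continuous.subtype_mk (continuous_Psi.comp continuous_subtype_val) _)

theorem pb_ne {u : zieglerPlus → ℂ} (hu : ∀ y, u y ≠ 0) (p : ℂ × ℂ) : pb u p ≠ 0 := by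
  unfold pb
  split_ifs
  · exact hu _
  · exact one_ne_zero

theorem pb_tr (u : zieglerPlus → ℂ) (p : ℂ × ℂ) : pb u (tr p) = pb u p := by
  by_cases h : Psi p ∈ zieglerPlus
  · rw [pb_eq u ⟨Psi p, h⟩ (Psi_tr p), pb_eq u ⟨Psi p, h⟩ rfl]
  · have h2 : Psi (tr p) ∉ zieglerPlus := by rwa [Psi_tr]
    rw [pb, pb, dif_neg h, dif_neg h2]

/-- The circle action on the complex complement. -/
noncomputable def rot (s : ℝ) (y : zieglerPlus) : zieglerPlus :=
  ⟨(exp (s * I) * y.1.1, exp (s * I) * y.1.2), by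
    have h := y.2
    simp only [zieglerPlus, mem_ofPred_eq] at h ⊢
    have e : ∀ E z w : ℂ, (E * z - E * w) * (E * z - 2 * (E * w)) * (E * z - 3 * (E * w)) *
      (E * z - 4 * (E * w)) = E ^ 4 * ((z - w) * (z - 2 * w) * (z - 3 * w) * (z - 4 * w)) := by
      intros; ring
    rw [e]
    exact mul_ne_zero (pow_ne_zero _ (exp_ne_zero _)) h⟩

theorem continuous_rot : Continuous fun q : ℝ × zieglerPlus => rot q.1 q.2 := by
  unfold rot
  exact Continuous.subtype_mk (by fun_prop) _

theorem rot_zero (y : zieglerPlus) : rot 0 y = y := by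
  ext <;> simp [rot]

theorem rot_per (s : ℝ) (y : zieglerPlus) : rot (s + 2 * Real.pi) y = rot s y := by
  have : exp (((s + 2 * Real.pi : ℝ) : ℂ) * I) = exp (s * I) := by
    rw [show ((s + 2 * Real.pi : ℝ) : ℂ) * I = s * I + 2 * Real.pi * I by push_cast; ring,
        exp_periodic]
  unfold rot
  simp only [this]

theorem lam_ne (y : zieglerPlus) : y.1.1 - 4 * y.1.2 ≠ 0 := right_ne_zero_of_mul y.2

theorem Psi_of {y : zieglerPlus} {η : ℂ} (h : exp η = y.1.1 - 4 * y.1.2) :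
    Psi (η, y.1.2 / (y.1.1 - 4 * y.1.2)) = y := by
  have := lam_ne y
  ext
  · simp only [Psi, h]; field_simp; ring
  · simp only [Psi, h]; field_simp

theorem plus1 {u : zieglerPlus → ℂ} (hu : Continuous u) (h0 : ∀ y, u y ≠ 0) :
    ∃ x : ℤ, ∀ y, W (fun s => u (rot s y)) x := by
  obtain ⟨x, hx⟩ := K0 (pb_cont hu) (fun p _ => pb_ne h0 p) (fun p _ => pb_tr u p)
  refine ⟨x, fun y => ?_⟩
  set η := log (y.1.1 - 4 * y.1.2) with hη
  set ζ := y.1.2 / (y.1.1 - 4 * y.1.2) with hζ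
  have hP : Psi (η, ζ) = y := Psi_of (exp_log (lam_ne y))
  have hV : (η, ζ) ∈ U 1 ∪ U (-1) := Psi_mem.1 (hP ▸ y.2)
  obtain ⟨σ, hσ, hU⟩ : ∃ σ : ℝ, (σ = 1 ∨ σ = -1) ∧ (η, ζ) ∈ U σ := by
    rcases hV with h | h
    · exact ⟨1, Or.inl rfl, h⟩
    · exact ⟨-1, Or.inr rfl, h⟩
  obtain ⟨L, hL, e, per⟩ := hx σ hσ
  have hm : ∀ s : ℝ, ((η + s * I, ζ) : ℂ × ℂ) ∈ U σ := fun s => hU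
  refine ⟨fun s => L (η + s * I, ζ), hL.comp_continuous (by fun_prop) hm, fun s => ?_, fun s => ?_⟩
  · rw [e _ (hm s)]
    refine pb_eq u _ ?_
    have h1 := congrArg Prod.fst hP
    have h2 := congrArg Prod.snd hP
    simp only [Psi] at h1 h2
    simp only [Psi, rot, exp_add]
    rw [← h1, ← h2]
    ext <;> simp only <;> ring
  · rw [← per _ (hm s), tr]
    have : η + ((s + 2 * Real.pi : ℝ) : ℂ) * I = η + s * I + 2 * Real.pi * I := by
      push_cast; ring
    simp only [this]

theorem plus2 {u : Fin 4 → zieglerPlus → ℂ} (hu : ∀ i, Continuous (u i)) (h0 : ∀ i y, u i y ≠ 0)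
    (hw : ∀ i y, W (fun s => u i (rot s y)) 0) :
    ∃ m : Fin 4 → ℤ, m ≠ 0 ∧ ∀ γ : ℝ → zieglerPlus, Continuous γ →
      (∀ t, γ (t + 2 * Real.pi) = γ t) → ∀ n : Fin 4 → ℤ,
      (∀ i, W (fun t => u i (γ t)) (n i)) → ∑ i, m i * n i = 0 := by
  have hb : Psi (0, 0) ∈ zieglerPlus := Psi_mem.2 (Or.inl (base_mem 1))
  obtain ⟨m, hm0, L, cL, eL, pL⟩ := K2 (h := fun i => pb (u i)) (fun i => pb_cont (hu i))
    (fun i p _ => pb_ne (h0 i) p) (fun i p _ => pb_tr (u i) p) (fun i => by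
      convert hw i ⟨Psi (0, 0), hb⟩ using 2 with t
      refine pb_eq (u i) _ ?_
      simp [Psi, rot])
  refine ⟨m, hm0, fun γ hγ per n hn => ?_⟩
  -- lift of the loop
  obtain ⟨k, hk⟩ := W.hom (H := fun q : ℝ × ℝ => (γ q.2).1.1 - 4 * (γ q.2).1.2) (by fun_prop)
    (fun q => lam_ne _) (fun r t => by simp only [per])
  obtain ⟨η, cη, eη, pη⟩ := hk 0
  let q : ℝ → ℂ × ℂ := fun t => (η t, (γ t).1.2 / ((γ t).1.1 - 4 * (γ t).1.2))
  have hq : Continuous q := by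
    refine cη.prodMk (Continuous.div (by fun_prop) (by fun_prop) fun t => lam_ne _)
  have hPq : ∀ t, Psi (q t) = γ t := fun t => Psi_of (eη t)
  have hqV : ∀ t, q t ∈ U 1 ∪ U (-1) := fun t => Psi_mem.1 (by rw [hPq]; exact (γ t).2)
  -- integer translations
  have shift : ∀ (j : ℕ) (p : ℂ × ℂ), p ∈ U 1 ∪ U (-1) →
      L (p.1 + j * (2 * Real.pi * I), p.2) = L p := by
    intro j
    induction j with
    | zero => intro p hp; simp
    | succ j ih =>
      intro p hp
      have h1 := ih (tr p) hp
      rw [pL p hp] at h1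
      rw [← h1]
      simp only [tr]
      congr 2
      push_cast; ring
  have shiftZ : ∀ (j : ℤ) (p : ℂ × ℂ), p ∈ U 1 ∪ U (-1) →
      L (p.1 + j * (2 * Real.pi * I), p.2) = L p := by
    intro j p hp
    obtain ⟨j, rfl | rfl⟩ := j.eq_nat_or_neg
    · exact_mod_cast shift j p hp
    · have := shift j (p.1 + ((-j : ℤ) : ℂ) * (2 * Real.pi * I), p.2) hp
      rw [← this]
      congr 1
      ext
      · push_cast; ring
      · rfl
  have hW0 : W (fun t => ∏ i, u i (γ t) ^ m i) 0 := by
    refine W.of_log (fun t => L (q t)) (cL.comp_continuous hq hqV) (fun t => ?_) (fun t => ?_)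
    · rw [eL _ (hqV t)]
      refine Finset.prod_congr rfl fun i _ => ?_
      rw [pb_eq (u i) (γ t) (hPq t)]
    · rw [← shiftZ k (q t) (hqV t)]
      simp only [q, pη, per]
  have hW1 : W (fun t => ∏ i, u i (γ t) ^ m i) (∑ i, m i * n i) := by
    simp only [Fin.prod_univ_four, Fin.sum_univ_four]
    exact ((((hn 0).zpow _).mul ((hn 1).zpow _)).mul ((hn 2).zpow _)).mul ((hn 3).zpow _)
  exact hW1.unique hW0

/-- The four real-linear forms. -/
noncomputable def al (i : Fin 4) (y : zieglerMinus) : ℂ :=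
  ![y.1.1 - (starRingEnd ℂ) y.1.2, y.1.1 - 2 * (starRingEnd ℂ) y.1.2,
    y.1.1 - 3 * y.1.2, y.1.1 - 4 * y.1.2] i

theorem al_cont (i : Fin 4) : Continuous (al i) := by
  have hconj : Continuous fun y : zieglerMinus => (starRingEnd ℂ) y.1.2 :=
    Complex.continuous_conj.comp (by fun_prop)
  have h1 : Continuous fun y : zieglerMinus => y.1.1 := by fun_prop
  have h2 : Continuous fun y : zieglerMinus => y.1.2 := by fun_prop
  fin_cases i
  · exact h1.sub hconj
  · exact h1.sub (continuous_const.mul hconj)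
  · exact h1.sub (continuous_const.mul h2)
  · exact h1.sub (continuous_const.mul h2)

theorem al_ne (i : Fin 4) (y : zieglerMinus) : al i y ≠ 0 := by
  have h := y.2
  simp only [zieglerMinus, mem_ofPred_eq, mul_ne_zero_iff] at h
  fin_cases i <;> simp [al] <;> tauto

theorem lin_ne {a b : ℝ} (ha : 0 ≤ a) (hb : 0 ≤ b) (hab : a ≠ b) {z : ℂ} (hz : z ≠ 0) :
    (a : ℂ) * z - b * (starRingEnd ℂ) z ≠ 0 := by
  rcases lt_or_gt_of_ne hab with h | h
  · exact ((W.const hz).lin' ha h).ne 0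
  · exact ((W.const hz).lin hb h).ne 0

/-- first map to the twice punctured plane -/
noncomputable def phi1 (y : zieglerMinus) : ℂ :=
  (((4 : ℝ) : ℂ) * al 2 y - ((1 : ℝ) : ℂ) * (starRingEnd ℂ) (al 2 y)) /
    (((3 : ℝ) : ℂ) * al 3 y - ((1 : ℝ) : ℂ) * (starRingEnd ℂ) (al 3 y))

/-- second map to the twice punctured plane -/
noncomputable def phi2 (y : zieglerMinus) : ℂ :=
  (((2 : ℝ) : ℂ) * al 0 y - ((3 : ℝ) : ℂ) * (starRingEnd ℂ) (al 0 y)) /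
    (((1 : ℝ) : ℂ) * al 1 y - ((3 : ℝ) : ℂ) * (starRingEnd ℂ) (al 1 y))

theorem phi1_sub (y : zieglerMinus) : phi1 y - 1 = al 0 y /
    (((3 : ℝ) : ℂ) * al 3 y - ((1 : ℝ) : ℂ) * (starRingEnd ℂ) (al 3 y)) := by
  have h := lin_ne (a := 3) (b := 1) (by norm_num) (by norm_num) (by norm_num) (al_ne 3 y)
  rw [phi1, div_sub_one h]
  congr 1
  have h4 : (starRingEnd ℂ) (4 : ℂ) = 4 := Complex.conj_ofNat 4
  have h3 : (starRingEnd ℂ) (3 : ℂ) = 3 := Complex.conj_ofNat 3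
  simp [al, h3, h4]
  ring

theorem phi2_sub (y : zieglerMinus) : phi2 y - 1 = al 2 y /
    (((1 : ℝ) : ℂ) * al 1 y - ((3 : ℝ) : ℂ) * (starRingEnd ℂ) (al 1 y)) := by
  have h := lin_ne (a := 1) (b := 3) (by norm_num) (by norm_num) (by norm_num) (al_ne 1 y)
  rw [phi2, div_sub_one h]
  congr 1
  have h2 : (starRingEnd ℂ) (2 : ℂ) = 2 := Complex.conj_ofNat 2
  simp [al, h2]
  ring

theorem lin_cont {a b : ℝ} (i : Fin 4) :
    Continuous fun y => (a : ℂ) * al i y - b * (starRingEnd ℂ) (al i y) := by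
  have h1 := al_cont i
  have h2 : Continuous fun y => (starRingEnd ℂ) (al i y) := Complex.continuous_conj.comp h1
  fun_prop

theorem phi1_prop : Continuous phi1 ∧ (∀ y, phi1 y ≠ 0) ∧ (∀ y, phi1 y ≠ 1) := by
  have hQ := fun y => lin_ne (a := 3) (b := 1) (by norm_num) (by norm_num) (by norm_num) (al_ne 3 y)
  have hP := fun y => lin_ne (a := 4) (b := 1) (by norm_num) (by norm_num) (by norm_num) (al_ne 2 y)
  refine ⟨(lin_cont 2).div (lin_cont 3) hQ, fun y => div_ne_zero (hP y) (hQ y), fun y => ?_⟩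
  rw [← sub_ne_zero, phi1_sub]
  exact div_ne_zero (al_ne 0 y) (hQ y)

theorem phi2_prop : Continuous phi2 ∧ (∀ y, phi2 y ≠ 0) ∧ (∀ y, phi2 y ≠ 1) := by
  have hQ := fun y => lin_ne (a := 1) (b := 3) (by norm_num) (by norm_num) (by norm_num) (al_ne 1 y)
  have hP := fun y => lin_ne (a := 2) (b := 3) (by norm_num) (by norm_num) (by norm_num) (al_ne 0 y)
  refine ⟨(lin_cont 0).div (lin_cont 1) hQ, fun y => div_ne_zero (hP y) (hQ y), fun y => ?_⟩
  rw [← sub_ne_zero, phi2_sub]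
  exact div_ne_zero (al_ne 2 y) (hQ y)

theorem phi1_W {γ : ℝ → zieglerMinus} {x : Fin 4 → ℤ} (h : ∀ i, W (fun t => al i (γ t)) (x i)) :
    W (fun t => phi1 (γ t)) (x 2 - x 3) ∧ W (fun t => phi1 (γ t) - 1) (x 0 - x 3) := by
  have hP := (h 2).lin (a := 4) (b := 1) (by norm_num) (by norm_num)
  have hQ := (h 3).lin (a := 3) (b := 1) (by norm_num) (by norm_num)
  refine ⟨hP.div hQ, ?_⟩
  simp only [phi1_sub]
  exact (h 0).div hQ

theorem phi2_W {γ : ℝ → zieglerMinus} {x : Fin 4 → ℤ} (h : ∀ i, W (fun t => al i (γ t)) (x i)) :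
    W (fun t => phi2 (γ t)) (-x 0 - -x 1) ∧ W (fun t => phi2 (γ t) - 1) (x 2 - -x 1) := by
  have hP := (h 0).lin' (a := 2) (b := 3) (by norm_num) (by norm_num)
  have hQ := (h 1).lin' (a := 1) (b := 3) (by norm_num) (by norm_num)
  refine ⟨hP.div hQ, ?_⟩
  simp only [phi2_sub]
  exact (h 2).div hQ

theorem circ_ne (c : ℝ) (hc : 1 ≤ |c|) (t : ℝ) : (c : ℂ) + 1 / 2 * exp (t * I) ≠ 0 := by
  intro h
  have h1 : ‖(c : ℂ)‖ = ‖-(1 / 2 * exp (t * I))‖ := by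
    congr 1; linear_combination h
  rw [norm_neg, norm_mul, norm_exp_ofReal_mul_I, norm_real, Real.norm_eq_abs] at h1
  norm_num at h1
  linarith

theorem circ_W (c : ℝ) (hc : 1 ≤ |c|) : W (fun t => (c : ℂ) + 1 / 2 * exp (t * I)) 0 := by
  have hper : ∀ t : ℝ, exp (((t + 2 * Real.pi : ℝ) : ℂ) * I) = exp (t * I) := fun t => by
    rw [show ((t + 2 * Real.pi : ℝ) : ℂ) * I = t * I + 2 * Real.pi * I by push_cast; ring,
        exp_periodic]
  obtain ⟨n, hn⟩ := W.hom
    (H := fun p : ℝ × ℝ => (c : ℂ) + ((1 / (2 * (1 + p.1 ^ 2)) : ℝ) : ℂ) * exp (p.2 * I))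
    (by
      have : Continuous fun p : ℝ × ℝ => (1 / (2 * (1 + p.1 ^ 2)) : ℝ) :=
        continuous_const.div (by fun_prop) (fun p => by positivity)
      fun_prop) (fun p h => by
        have h1 : ‖(c : ℂ)‖ = ‖-(((1 / (2 * (1 + p.1 ^ 2)) : ℝ) : ℂ) * exp (p.2 * I))‖ := by
          congr 1; linear_combination h
        rw [norm_neg, norm_mul, norm_exp_ofReal_mul_I, norm_real, norm_real, Real.norm_eq_abs,
          Real.norm_of_nonneg (by positivity), mul_one] at h1
        rw [h1, le_div_iff₀ (by positivity)] at hc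
        nlinarith [sq_nonneg p.1])
    (fun r t => by simp only [hper])
  rcases le_abs.1 hc with h | h
  · refine W.of_slit (by fun_prop) (fun t => ?_) (fun t => by simp only [hper])
    left
    have := Real.neg_one_le_cos t
    rw [show (1 / 2 : ℂ) = ((1 / 2 : ℝ) : ℂ) by push_cast; ring, add_re, ofReal_re, re_ofReal_mul,
      exp_ofReal_mul_I_re]
    linarith
  · have h3 : W (fun t => ((-c : ℝ) : ℂ) - 1 / 2 * exp (t * I)) 0 := by
      refine W.of_slit (by fun_prop) (fun t => ?_) (fun t => by simp only [hper])
      left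
      have := Real.cos_le_one t
      rw [show (1 / 2 : ℂ) = ((1 / 2 : ℝ) : ℂ) by push_cast; ring, sub_re, ofReal_re,
        re_ofReal_mul, exp_ofReal_mul_I_re]
      linarith
    have h4 := h3.mul (W.const (c := -1) (by norm_num))
    rw [add_zero] at h4
    convert h4 using 2 with t
    push_cast; ring

/-- meridian loops -/
theorem loops (k : Fin 4) : ∃ γ : ℝ → zieglerMinus, Continuous γ ∧
    (∀ t, γ (t + 2 * Real.pi) = γ t) ∧
    ∀ i, W (fun t => al i (γ t)) (if i = k then 1 else 0) := by
  have hper : ∀ t : ℝ, exp (((t + 2 * Real.pi : ℝ) : ℂ) * I) = exp (t * I) := fun t => by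
    rw [show ((t + 2 * Real.pi : ℝ) : ℂ) * I = t * I + 2 * Real.pi * I by push_cast; ring,
        exp_periodic]
  let β : ℝ → ℂ × ℂ := fun t => (((k : ℕ) + 1 : ℂ) + 1 / 2 * exp (t * I), 1)
  have hβ : ∀ i : Fin 4,
      W (fun t => (β t).1 - ((i : ℕ) + 1 : ℂ)) (if i = k then 1 else 0) := by
    intro i
    by_cases hik : i = k
    · subst hik
      rw [if_pos rfl]
      convert W.circle (c := 1 / 2) (by norm_num) using 2 with t
      simp only [β]; ring
    · rw [if_neg hik]
      convert circ_W ((k : ℕ) - (i : ℕ) : ℝ) ?_ using 2 with t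
      · simp only [β]; push_cast; ring
      · have h1 : ((k : ℕ) : ℤ) - (i : ℕ) ≠ 0 := by
          intro h; apply hik; ext; omega
        have := Int.one_le_abs h1
        exact_mod_cast this
  have hmem : ∀ t, β t ∈ zieglerMinus := by
    intro t
    have h0 := (hβ 0).ne t
    have h1 := (hβ 1).ne t
    have h2 := (hβ 2).ne t
    have h3 := (hβ 3).ne t
    simp only [zieglerMinus, mem_ofPred_eq]
    have e : (β t).2 = 1 := rfl
    rw [e, map_one]
    norm_num at h0 h1 h2 h3
    norm_num
    exact ⟨⟨⟨h0, h1⟩, h2⟩, h3⟩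
  refine ⟨fun t => ⟨β t, hmem t⟩, Continuous.subtype_mk (by fun_prop) _,
    fun t => by simp only [β, hper], fun i => ?_⟩
  convert hβ i using 2 with t
  have e : (β t).2 = 1 := rfl
  fin_cases i <;> simp [al, e] <;> norm_num

theorem main (e : ContinuousMap.HomotopyEquiv zieglerPlus zieglerMinus) : False := by
  set f : zieglerPlus → zieglerMinus := ⇑e.toFun with hf
  set g : zieglerMinus → zieglerPlus := ⇑e.invFun with hg
  have cf : Continuous f := e.toFun.continuous
  have cg : Continuous g := e.invFun.continuous
  obtain ⟨K⟩ := e.right_inv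
  choose ℓ cℓ pℓ wℓ using loops
  have wfg : ∀ k i, W (fun t => al i (f (g (ℓ k t)))) (if i = k then 1 else 0) := by
    intro k i
    obtain ⟨n, hn⟩ := W.hom
      (H := fun p : ℝ × ℝ => al i (K (projIcc 0 1 zero_le_one p.1, ℓ k p.2)))
      ((al_cont i).comp (K.continuous.comp
        ((continuous_projIcc.comp continuous_fst).prodMk ((cℓ k).comp continuous_snd))))
      (fun p => al_ne _ _) (fun r t => by simp only [pℓ])
    have h0 := hn 0
    have h1 := hn 1
    simp only [projIcc_left, projIcc_right] at h0 h1
    have e1 : W (fun t => al i (ℓ k t)) n := by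
      convert h1 using 3 with t
      exact (K.apply_one _).symm
    have e0 : W (fun t => al i (f (g (ℓ k t)))) n := by
      convert h0 using 3 with t
      exact (K.apply_zero _).symm
    rwa [e1.unique (wℓ k i)] at e0
  have hx := fun i => plus1 (u := fun y => al i (f y)) ((al_cont i).comp cf) (fun y => al_ne _ _)
  choose x hx using hx
  -- torus argument
  have tor : ∀ (φ : zieglerMinus → ℂ), (Continuous φ ∧ (∀ y, φ y ≠ 0) ∧ ∀ y, φ y ≠ 1) →
      ∀ (k : Fin 4) (a b c d : ℤ),
      W (fun s => φ (f (rot s (g (ℓ k 0))))) a → W (fun t => φ (f (g (ℓ k t)))) b →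
      W (fun s => φ (f (rot s (g (ℓ k 0)))) - 1) c → W (fun t => φ (f (g (ℓ k t))) - 1) d →
      a * d = b * c := by
    rintro φ ⟨cφ, n0, n1⟩ k a b c d ha hb hc hd
    refine torus (T := fun p => φ (f (rot p.1 (g (ℓ k p.2))))) ?_ (fun p => n0 _) (fun p => n1 _)
      (fun s t => by simp only [rot_per]) (fun s t => by simp only [pℓ]) ha ?_ hc ?_
    · exact cφ.comp (cf.comp (continuous_rot.comp
        (continuous_fst.prodMk (cg.comp ((cℓ k).comp continuous_snd)))))
    · simpa only [rot_zero] using hb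
    · simpa only [rot_zero] using hd
  have t1 := fun k => tor phi1 phi1_prop k _ _ _ _
    (phi1_W (γ := fun s => f (rot s (g (ℓ k 0)))) (fun i => hx i _)).1 (phi1_W (wfg k)).1
    (phi1_W (γ := fun s => f (rot s (g (ℓ k 0)))) (fun i => hx i _)).2 (phi1_W (wfg k)).2
  have t2 := fun k => tor phi2 phi2_prop k _ _ _ _
    (phi2_W (γ := fun s => f (rot s (g (ℓ k 0)))) (fun i => hx i _)).1 (phi2_W (wfg k)).1
    (phi2_W (γ := fun s => f (rot s (g (ℓ k 0)))) (fun i => hx i _)).2 (phi2_W (wfg k)).2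
  have a1 := t1 0
  have a2 := t1 2
  have a3 := t2 0
  have a4 := t2 2
  simp at a1 a2 a3 a4
  have hx0 : ∀ i, x i = 0 := by
    intro i
    fin_cases i <;> simp <;> omega
  obtain ⟨m, hm0, hm⟩ := plus2 (u := fun i y => al i (f y)) (fun i => (al_cont i).comp cf)
    (fun i y => al_ne _ _) (fun i y => by
      have := hx i y
      rwa [hx0 i] at this)
  apply hm0
  funext k
  have := hm (fun t => g (ℓ k t)) (cg.comp (cℓ k)) (fun t => by simp only [pℓ]) _ (wfg k)
  simpa using this

end Zieg

/-- The complements of Ziegler's pair of arrangements are not homotopy equivalent. -/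
theorem ziegler_pair_not_homotopy_equivalent :
    IsEmpty (ContinuousMap.HomotopyEquiv zieglerPlus zieglerMinus) := by
  exact ⟨Zieg.main⟩
end

section
/- Let i = √−1 and let g(z, w) = (z − ((5−5i)/2)w + ((3−5i)/2)w̄) · (z − ((7−10i)/2)w + ((3−10i)/2)w̄) · (z − ((5−14i)/2)w − ((3+14i)/2)w̄) · (z − ((7−9i)/2)w − ((3+9i)/2)w̄) · (z − 6w). Define f_K(z, w) = g(z, w)·(z − 7w) and f_L(z, w) = g(z, w)·(z − ((6−7i)/2)w − ((3+14i)/2)w̄). Let X_K = {(z, w) ∈ ℂ² : f_K(z, w) ≠ 0} and X_L = {(z, w) ∈ ℂ² : f_L(z, w) ≠ 0}, with the subspace topology. Then X_K and X_L are not homotopy equivalent. -/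
open Complex in
/-- The common degree-5 factor of the defining polynomials of Mazurovskiĭ's
arrangements `K` and `L`. -/
noncomputable def mazG (z w : ℂ) : ℂ :=
  (z - ((5 - 5 * I) / 2) * w + ((3 - 5 * I) / 2) * (starRingEnd ℂ) w) *
  (z - ((7 - 10 * I) / 2) * w + ((3 - 10 * I) / 2) * (starRingEnd ℂ) w) *
  (z - ((5 - 14 * I) / 2) * w - ((3 + 14 * I) / 2) * (starRingEnd ℂ) w) *
  (z - ((7 - 9 * I) / 2) * w - ((3 + 9 * I) / 2) * (starRingEnd ℂ) w) *
  (z - 6 * w)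

/-- Defining polynomial of Mazurovskiĭ's arrangement `K = A(341256)`. -/
noncomputable def mazFK (z w : ℂ) : ℂ := mazG z w * (z - 7 * w)

open Complex in
/-- Defining polynomial of Mazurovskiĭ's arrangement `L`. -/
noncomputable def mazFL (z w : ℂ) : ℂ :=
  mazG z w * (z - ((6 - 7 * I) / 2) * w - ((3 + 14 * I) / 2) * (starRingEnd ℂ) w)

namespace Maz
open Complex Set Topology

/-- A continuous logarithm on `U`. -/
def LiftsOn {E : Type*} [TopologicalSpace E] (x : E → ℂ) (U : Set E) : Prop :=
  ∃ h : E → ℂ, ContinuousOn h U ∧ ∀ p ∈ U, x p = exp (h p)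

lemma const_diff {E : Type*} [TopologicalSpace E] {S : Set E} (hS : IsPreconnected S)
    {h₁ h₂ : E → ℂ} (c₁ : ContinuousOn h₁ S) (c₂ : ContinuousOn h₂ S)
    (he : ∀ p ∈ S, exp (h₁ p) = exp (h₂ p)) :
    ∃ n : ℤ, ∀ p ∈ S, h₁ p = h₂ p + n * (2 * Real.pi * I) := by
  have hd : IsDiscrete ((AddSubgroup.zmultiples (2 * Real.pi * I : ℂ)) : Set ℂ) :=
    ⟨NormedSpace.discreteTopology_zmultiples _⟩
  obtain ⟨y, hy, hc⟩ := hS.eqOn_const_of_mapsTo hd (c₁.sub c₂) (by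
    intro p hp
    obtain ⟨n, hn⟩ := exp_eq_exp_iff_exists_int.1 (he p hp)
    refine AddSubgroup.mem_zmultiples_iff.2 ⟨n, ?_⟩
    simp [hn]) ⟨0, AddSubgroup.zero_mem _⟩
  obtain ⟨n, hn⟩ := AddSubgroup.mem_zmultiples_iff.1 hy
  refine ⟨n, fun p hp => ?_⟩
  have := hc hp
  simp only [Pi.sub_apply, Function.const_apply] at this
  rw [← zsmul_eq_mul, hn, ← this]; ring

lemma liftsOn_union {E : Type*} [TopologicalSpace E] {x : E → ℂ} {U V : Set E}
    (hU : IsOpen U) (hV : IsOpen V) (lU : LiftsOn x U) (lV : LiftsOn x V)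
    (hc : IsPreconnected (U ∩ V)) : LiftsOn x (U ∪ V) := by
  classical
  obtain ⟨h, ch, eh⟩ := lU
  obtain ⟨k, ck, ek⟩ := lV
  obtain ⟨n, hn⟩ := const_diff hc (ch.mono inter_subset_left) (ck.mono inter_subset_right)
    (fun p hp => by rw [← eh p hp.1, ← ek p hp.2])
  refine ⟨fun p => if p ∈ U then h p else k p + n * (2 * Real.pi * I), ?_, ?_⟩
  · refine ContinuousOn.union_of_isOpen ?_ ?_ hU hV
    · exact ch.congr (fun p hp => by simp [hp])
    · refine (ck.add (continuousOn_const (c := (n * (2 * Real.pi * I) : ℂ)))).congr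
        (fun p hp => ?_)
      by_cases hpU : p ∈ U
      · simp [hpU, hn p ⟨hpU, hp⟩]
      · simp [hpU]
  · intro p hp
    by_cases hpU : p ∈ U
    · simp [hpU, eh p hpU]
    · have hpV : p ∈ V := hp.resolve_left hpU
      simp only [hpU, if_false]
      rw [ek p hpV, exp_add, exp_int_mul_two_pi_mul_I, mul_one]

lemma liftsOn_convex {E : Type*} [NormedAddCommGroup E] [NormedSpace ℝ E] {x : E → ℂ} {U : Set E}
    (hU : IsOpen U) (hc : Convex ℝ U) (cx : ContinuousOn x U) (nx : ∀ p ∈ U, x p ≠ 0) :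
    LiftsOn x U := by
  rcases U.eq_empty_or_nonempty with rfl | hne
  · exact ⟨0, continuousOn_empty _, by simp⟩
  have : ContractibleSpace U := hc.contractibleSpace hne
  have hs : SimplyConnectedSpace U := inferInstance
  have hsc : IsSimplyConnected U := by
    simpa [IsSimplyConnected] using hs
  obtain ⟨f, cf, ef⟩ := exists_continuousOn_eqOn_exp_comp hsc hU cx
    (by rintro ⟨p, hp, h⟩; exact nx p hp h)
  exact ⟨f, cf, fun p hp => (ef hp).symm⟩

lemma lifts_global {E : Type*} [NormedAddCommGroup E] [NormedSpace ℝ E] {x : E → ℂ}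
    (cx : Continuous x) (nx : ∀ p, x p ≠ 0) :
    ∃ h : E → ℂ, Continuous h ∧ ∀ p, x p = exp (h p) := by
  obtain ⟨h, ch, eh⟩ := liftsOn_convex isOpen_univ convex_univ cx.continuousOn (fun p _ => nx p)
  exact ⟨h, continuousOn_univ.1 ch, fun p => eh p trivial⟩

/-- `x` and `y` define the same class. -/
def Sim {X : Type*} [TopologicalSpace X] (x y : X → ℂ) : Prop :=
  ∃ h : X → ℂ, Continuous h ∧ ∀ p, x p = y p * exp (h p)

section Sim
variable {X Y : Type*} [TopologicalSpace X] [TopologicalSpace Y] {x y z x' y' : X → ℂ}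

lemma Sim.refl (x : X → ℂ) : Sim x x := ⟨0, continuous_const, by simp⟩

lemma Sim.symm (h : Sim x y) : Sim y x := by
  obtain ⟨k, ck, ek⟩ := h
  exact ⟨fun p => - k p, ck.neg, fun p => by rw [ek, mul_assoc, ← exp_add]; simp⟩

lemma Sim.trans (h : Sim x y) (h' : Sim y z) : Sim x z := by
  obtain ⟨k, ck, ek⟩ := h
  obtain ⟨l, cl, el⟩ := h'
  exact ⟨fun p => l p + k p, cl.add ck, fun p => by rw [ek, el, exp_add, mul_assoc]⟩

lemma Sim.mul (h : Sim x y) (h' : Sim x' y') : Sim (fun p => x p * x' p) (fun p => y p * y' p) := by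
  obtain ⟨k, ck, ek⟩ := h
  obtain ⟨l, cl, el⟩ := h'
  exact ⟨fun p => k p + l p, ck.add cl, fun p => by
    simp only [ek, el, exp_add]; ring⟩

lemma Sim.zpow (h : Sim x y) (n : ℤ) : Sim (fun p => x p ^ n) (fun p => y p ^ n) := by
  obtain ⟨k, ck, ek⟩ := h
  exact ⟨fun p => n * k p, continuous_const.mul ck, fun p => by
    simp only [ek, mul_zpow, exp_int_mul]⟩

lemma Sim.div (h : Sim x y) (h' : Sim x' y') : Sim (fun p => x p / x' p) (fun p => y p / y' p) := by
  have := h.mul (h'.zpow (-1))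
  simpa [div_eq_mul_inv] using this

lemma Sim.prod {ι : Type*} (s : Finset ι) {x y : ι → X → ℂ} (h : ∀ i, Sim (x i) (y i)) :
    Sim (fun p => ∏ i ∈ s, x i p) (fun p => ∏ i ∈ s, y i p) := by
  choose k ck ek using h
  refine ⟨fun p => ∑ i ∈ s, k i p, continuous_finsetSum _ (fun i _ => ck i), fun p => ?_⟩
  rw [exp_sum, ← Finset.prod_mul_distrib]
  exact Finset.prod_congr rfl (fun i _ => ek i p)

lemma Sim.comp (h : Sim x y) {f : Y → X} (cf : Continuous f) :
    Sim (fun p => x (f p)) (fun p => y (f p)) := by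
  obtain ⟨k, ck, ek⟩ := h
  exact ⟨fun p => k (f p), ck.comp cf, fun p => ek _⟩

lemma Sim.of_slit (cx : Continuous x) (cy : Continuous y) (ny : ∀ p, y p ≠ 0)
    (h : ∀ p, x p / y p ∈ slitPlane) : Sim x y := by
  refine ⟨fun p => log (x p / y p), (cx.div cy ny).clog h, fun p => ?_⟩
  rw [exp_log (slitPlane_ne_zero (h p)), mul_div_cancel₀ _ (ny p)]

lemma Sim.of_homotopic {f g : C(Y, X)} (H : f.Homotopic g) (cx : Continuous x)
    (nx : ∀ p, x p ≠ 0) : Sim (fun p => x (f p)) (fun p => x (g p)) := by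
  obtain ⟨F⟩ := H.symm
  have cov := isCoveringMap_exp
  let G : C(unitInterval × Y, {z : ℂ // z ≠ 0}) :=
    ⟨fun q => ⟨x (F q) / x (g q.2), div_ne_zero (nx _) (nx _)⟩, by
      refine Continuous.subtype_mk ?_ _
      exact (cx.comp F.continuous).div (cx.comp (g.continuous.comp continuous_snd)) (fun _ => nx _)⟩
  have G0 : ∀ a, G (0, a) = (fun z : ℂ ↦ (⟨_, z.exp_ne_zero⟩ : {z : ℂ // z ≠ 0}))
      ((ContinuousMap.const Y (0 : ℂ)) a) := by
    intro a
    apply Subtype.ext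
    simp [G, nx]
  have hl := cov.liftHomotopy_lifts G _ G0
  refine ⟨fun p => cov.liftHomotopy G _ G0 (1, p), by fun_prop, fun p => ?_⟩
  have := congrArg Subtype.val (congrFun hl (1, p))
  simp only [Function.comp_apply] at this
  rw [this]
  simp [G]
  rw [mul_div_cancel₀ _ (nx _)]

end Sim

/-- `F` on the plane has a logarithm with prescribed periods. -/
def HasDeg (F : ℝ × ℝ → ℂ) (m n : ℤ) : Prop :=
  ∃ h : ℝ × ℝ → ℂ, Continuous h ∧ (∀ p, F p = exp (h p)) ∧
    (∀ s t, h (s + 2 * Real.pi, t) = h (s, t) + m * (2 * Real.pi * I)) ∧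
    (∀ s t, h (s, t + 2 * Real.pi) = h (s, t) + n * (2 * Real.pi * I))

/-- doubly periodic -/
def Per {α : Type*} (F : ℝ × ℝ → α) : Prop :=
  (∀ s t, F (s + 2 * Real.pi, t) = F (s, t)) ∧ (∀ s t, F (s, t + 2 * Real.pi) = F (s, t))

lemma two_pi_I_ne : (2 * Real.pi * I : ℂ) ≠ 0 := two_pi_I_ne_zero

lemma const_diff_global {h k : ℝ × ℝ → ℂ} (ch : Continuous h) (ck : Continuous k)
    (he : ∀ p, exp (h p) = exp (k p)) :
    ∃ n : ℤ, ∀ p, h p = k p + n * (2 * Real.pi * I) := by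
  obtain ⟨n, hn⟩ := const_diff (S := univ) isPreconnected_univ ch.continuousOn ck.continuousOn
    (fun p _ => he p)
  exact ⟨n, fun p => hn p trivial⟩

lemma HasDeg.exists {F : ℝ × ℝ → ℂ} (cF : Continuous F) (nF : ∀ p, F p ≠ 0) (hF : Per F) :
    ∃ m n, HasDeg F m n := by
  obtain ⟨h, ch, eh⟩ := lifts_global cF nF
  obtain ⟨m, hm⟩ := const_diff_global (h := fun p => h (p.1 + 2 * Real.pi, p.2)) (k := h)
    (by fun_prop) ch (fun p => by rw [← eh, ← eh]; exact hF.1 _ _)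
  obtain ⟨n, hn⟩ := const_diff_global (h := fun p => h (p.1, p.2 + 2 * Real.pi)) (k := h)
    (by fun_prop) ch (fun p => by rw [← eh, ← eh]; exact hF.2 _ _)
  exact ⟨m, n, h, ch, eh, fun s t => hm (s, t), fun s t => hn (s, t)⟩

lemma HasDeg.unique {F : ℝ × ℝ → ℂ} {m n m' n' : ℤ} (h : HasDeg F m n) (h' : HasDeg F m' n') :
    m = m' ∧ n = n' := by
  obtain ⟨h, ch, eh, h1, h2⟩ := h
  obtain ⟨k, ck, ek, k1, k2⟩ := h'
  obtain ⟨j, hj⟩ := const_diff_global ch ck (fun p => by rw [← eh, ← ek])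
  have a1 := h1 0 0
  have a2 := h2 0 0
  rw [hj, hj (0, 0), k1] at a1
  rw [hj, hj (0, 0), k2] at a2
  constructor
  · have : (m' : ℂ) = m := mul_right_cancel₀ two_pi_I_ne (by linear_combination a1)
    exact_mod_cast this.symm
  · have : (n' : ℂ) = n := mul_right_cancel₀ two_pi_I_ne (by linear_combination a2)
    exact_mod_cast this.symm

lemma HasDeg.mul {F G : ℝ × ℝ → ℂ} {m n m' n' : ℤ} (h : HasDeg F m n) (h' : HasDeg G m' n') :
    HasDeg (fun p => F p * G p) (m + m') (n + n') := by
  obtain ⟨h, ch, eh, h1, h2⟩ := h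
  obtain ⟨k, ck, ek, k1, k2⟩ := h'
  refine ⟨fun p => h p + k p, ch.add ck, fun p => ?_, fun s t => ?_, fun s t => ?_⟩
  · simp only [eh, ek, exp_add]
  · simp only [h1, k1]; push_cast; ring
  · simp only [h2, k2]; push_cast; ring

lemma HasDeg.zpow {F : ℝ × ℝ → ℂ} {m n : ℤ} (h : HasDeg F m n) (j : ℤ) :
    HasDeg (fun p => F p ^ j) (j * m) (j * n) := by
  obtain ⟨h, ch, eh, h1, h2⟩ := h
  refine ⟨fun p => j * h p, continuous_const.mul ch, fun p => ?_, fun s t => ?_, fun s t => ?_⟩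
  · simp only [eh, exp_int_mul]
  · simp only [h1]; push_cast; ring
  · simp only [h2]; push_cast; ring

lemma HasDeg.one : HasDeg (fun _ => 1) 0 0 :=
  ⟨fun _ => 0, continuous_const, by simp, by simp, by simp⟩

lemma HasDeg.prod {ι : Type*} (s : Finset ι) {F : ι → ℝ × ℝ → ℂ} {m n : ι → ℤ}
    (h : ∀ i, HasDeg (F i) (m i) (n i)) :
    HasDeg (fun p => ∏ i ∈ s, F i p) (∑ i ∈ s, m i) (∑ i ∈ s, n i) := by
  classical
  induction s using Finset.induction_on with
  | empty => simpa using HasDeg.one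
  | insert a s ha ih =>
    simp only [Finset.prod_insert ha, Finset.sum_insert ha]
    exact (h a).mul ih

lemma HasDeg.of_per {F k : ℝ × ℝ → ℂ} (ck : Continuous k) (pk : Per k) (hF : ∀ p, F p = exp (k p)) :
    HasDeg F 0 0 := by
  refine ⟨k, ck, hF, fun s t => ?_, fun s t => ?_⟩
  · simp [pk.1]
  · simp [pk.2]

lemma Per.comp {α β : Type*} {F : ℝ × ℝ → α} (hF : Per F) (g : α → β) : Per (fun p => g (F p)) :=
  ⟨fun s t => by simp only [hF.1], fun s t => by simp only [hF.2]⟩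

lemma HasDeg.sim {X : Type*} [TopologicalSpace X] {x y : X → ℂ} (h : Sim x y)
    {T : ℝ × ℝ → X} (cT : Continuous T) (pT : Per T) {m n : ℤ}
    (hd : HasDeg (fun p => y (T p)) m n) : HasDeg (fun p => x (T p)) m n := by
  obtain ⟨k, ck, ek⟩ := h
  have := hd.mul (HasDeg.of_per (F := fun p => exp (k (T p))) (ck.comp cT) (pT.comp k)
    (fun p => rfl))
  simpa [ek] using this

lemma HasDeg.of_slit {F G : ℝ × ℝ → ℂ} (cF : Continuous F) (cG : Continuous G) (pF : Per F)
    (pG : Per G) (nG : ∀ p, G p ≠ 0) (h : ∀ p, F p / G p ∈ slitPlane) {m n : ℤ}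
    (hd : HasDeg G m n) : HasDeg F m n := by
  have h1 : HasDeg (fun p => F p / G p) 0 0 := by
    refine HasDeg.of_per (k := fun p => log (F p / G p)) ((cF.div cG nG).clog h) ?_ (fun p => ?_)
    · exact ⟨fun s t => by simp only [pF.1, pG.1], fun s t => by simp only [pF.2, pG.2]⟩
    · rw [exp_log (slitPlane_ne_zero (h p))]
  have := hd.mul h1
  simp only [add_zero] at this
  convert this using 2 with p
  rw [mul_div_cancel₀ _ (nG p)]

/-- Torus lemma: a map of a torus to a wedge of two circles. -/
lemma torus {a b : ℝ × ℝ → ℂ} {m n m' n' : ℤ} (ha : HasDeg a m n) (hb : HasDeg b m' n')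
    (hab : ∀ p, a p = 1 ∨ b p = 1) : m * n' = n * m' := by
  classical
  have ca : Continuous a := by
    obtain ⟨A, cA, eA, -⟩ := ha
    rw [funext eA]; fun_prop
  have cb : Continuous b := by
    obtain ⟨A, cA, eA, -⟩ := hb
    rw [funext eA]; fun_prop
  obtain ⟨A, cA, eA, A1, A2⟩ := ha
  obtain ⟨B, cB, eB, B1, B2⟩ := hb
  set w : ℂ := 2 * Real.pi * I with hw
  have hw0 : w ≠ 0 := two_pi_I_ne
  have iA : ∀ p, a p = 1 → ∃ j : ℤ, A p = j * w := fun p hp => by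
    rw [eA, exp_eq_one_iff] at hp; exact hp
  have iB : ∀ p, b p = 1 → ∃ j : ℤ, B p = j * w := fun p hp => by
    rw [eB, exp_eq_one_iff] at hp; exact hp
  let d : ℝ × ℝ → ℂ := fun p => if a p = 1 then exp (A p * B p / w) else 1
  have d1 : ∀ p, a p = 1 → d p = exp (A p * B p / w) := fun p hp => by simp [d, hp]
  have d2 : ∀ p, b p = 1 → d p = 1 := fun p hp => by
    by_cases h : a p = 1
    · rw [d1 p h]
      obtain ⟨i, hi⟩ := iA p h
      obtain ⟨j, hj⟩ := iB p hp
      rw [exp_eq_one_iff]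
      refine ⟨i * j, ?_⟩
      rw [hi, hj, ← hw]; field_simp; push_cast; ring
    · simp [d, h]
  have cd : Continuous d := by
    have hc : univ ⊆ {p | a p = 1} ∪ {p | b p = 1} := fun p _ => hab p
    have h1 : IsClosed {p | a p = 1} := isClosed_eq ca continuous_const
    have h2 : IsClosed {p | b p = 1} := isClosed_eq cb continuous_const
    rw [← continuousOn_univ]
    refine ContinuousOn.mono ?_ hc
    refine ContinuousOn.union_of_isClosed ?_ ?_ h1 h2
    · exact (Continuous.continuousOn (f := fun p => exp (A p * B p / w)) (by fun_prop)).congr d1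
    · exact (continuousOn_const (c := (1 : ℂ))).congr d2
  have nd : ∀ p, d p ≠ 0 := fun p => by
    rcases hab p with h | h
    · rw [d1 p h]; exact exp_ne_zero _
    · rw [d2 p h]; exact one_ne_zero
  obtain ⟨D, cD, eD⟩ := lifts_global cd nd
  have aper : ∀ s t, a (s + 2 * Real.pi, t) = a (s, t) := fun s t => by
    rw [eA, eA, A1, exp_add, exp_int_mul_two_pi_mul_I, mul_one]
  have aper2 : ∀ s t, a (s, t + 2 * Real.pi) = a (s, t) := fun s t => by
    rw [eA, eA, A2, exp_add, exp_int_mul_two_pi_mul_I, mul_one]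
  have bper : ∀ s t, b (s + 2 * Real.pi, t) = b (s, t) := fun s t => by
    rw [eB, eB, B1, exp_add, exp_int_mul_two_pi_mul_I, mul_one]
  have bper2 : ∀ s t, b (s, t + 2 * Real.pi) = b (s, t) := fun s t => by
    rw [eB, eB, B2, exp_add, exp_int_mul_two_pi_mul_I, mul_one]
  have key : ∀ p q, ∀ j k : ℤ, A q = A p + j * w → B q = B p + k * w → a q = a p → b q = b p →
      d q = d p * exp (j * B p) := by
    intro p q j k hA hB ha hb
    rcases hab p with h | h
    · rw [d1 p h, d1 q (ha.trans h), hA, hB, ← exp_add, exp_eq_exp_iff_exists_int]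
      obtain ⟨i, hi⟩ := iA p h
      refine ⟨i * k + j * k, ?_⟩
      rw [hi, ← hw]; field_simp; push_cast; ring
    · rw [d2 p h, d2 q (hb.trans h), one_mul, eq_comm, exp_eq_one_iff]
      obtain ⟨i, hi⟩ := iB p h
      refine ⟨j * i, ?_⟩
      rw [hi, ← hw]; push_cast; ring
  obtain ⟨c1, hc1⟩ := const_diff_global (h := fun p => D (p.1 + 2 * Real.pi, p.2))
    (k := fun p => D p + m * B p) (by fun_prop) (by fun_prop) (fun p => by
      rw [← eD, exp_add, ← eD]
      exact key p _ m m' (A1 _ _) (B1 _ _) (aper _ _) (bper _ _))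
  obtain ⟨c2, hc2⟩ := const_diff_global (h := fun p => D (p.1, p.2 + 2 * Real.pi))
    (k := fun p => D p + n * B p) (by fun_prop) (by fun_prop) (fun p => by
      rw [← eD, exp_add, ← eD]
      exact key p _ n n' (A2 _ _) (B2 _ _) (aper2 _ _) (bper2 _ _))
  have e1 := hc1 (0, 0 + 2 * Real.pi)
  have e2 := hc2 (0, 0)
  have e3 := hc2 (0 + 2 * Real.pi, 0)
  have e4 := hc1 (0, 0)
  simp only [B1, B2] at e1 e2 e3 e4
  have : (m : ℂ) * n' * w = n * m' * w := by
    linear_combination (-1 : ℂ) * e1 - e2 + e3 + e4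
  have := mul_right_cancel₀ hw0 this
  exact_mod_cast this

/-- collapsing map -/
noncomputable def kap (u : ℂ) : ℂ := if u.re ≤ 0 then 1 else -(u / ‖u‖) ^ 2

/-- the forms -/
def phi (A B : Fin 6 → ℂ) (k : Fin 6) (p : ℂ × ℂ) : ℂ :=
  p.1 - A k * p.2 - B k * (starRingEnd ℂ) p.2

def XX (A B : Fin 6 → ℂ) : Set (ℂ × ℂ) := {p | ∀ k, phi A B k p ≠ 0}

lemma phi_cont (A B : Fin 6 → ℂ) (k : Fin 6) : Continuous (phi A B k) := by
  unfold phi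
  have : Continuous (starRingEnd ℂ) := continuous_conj
  fun_prop

noncomputable def tor (A B : Fin 6 → ℂ) (e : ℝ) (i : Fin 6) (p : ℝ × ℝ) : ℂ × ℂ :=
  (A i * exp (p.2 * I) + B i * (starRingEnd ℂ) (exp (p.2 * I)) + e * exp (p.1 * I), exp (p.2 * I))

lemma tor_cont (A B : Fin 6 → ℂ) (e : ℝ) (i : Fin 6) : Continuous (tor A B e i) := by
  unfold tor
  have : Continuous (starRingEnd ℂ) := continuous_conj
  fun_prop

lemma exp_per (t : ℝ) : exp (((t + 2 * Real.pi : ℝ) : ℂ) * I) = exp (t * I) := by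
  push_cast
  rw [add_mul, exp_add, exp_two_pi_mul_I, mul_one]

lemma tor_per (A B : Fin 6 → ℂ) (e : ℝ) (i : Fin 6) : Per (tor A B e i) := by
  constructor
  · intro s t
    simp only [tor, exp_per]
  · intro s t
    simp only [tor, exp_per]

lemma phi_tor (A B : Fin 6 → ℂ) (e : ℝ) (i j : Fin 6) (p : ℝ × ℝ) :
    phi A B j (tor A B e i p) = (A i - A j) * exp (p.2 * I) +
      (B i - B j) * (starRingEnd ℂ) (exp (p.2 * I)) + e * exp (p.1 * I) := by
  simp only [phi, tor]; ring

/-- linking signs -/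
noncomputable def lk (A B : Fin 6 → ℂ) (i j : Fin 6) : ℤ :=
  if normSq (B i - B j) < normSq (A i - A j) then 1 else -1

lemma norm_conj_exp (t : ℝ) : ‖(starRingEnd ℂ) (exp (t * I))‖ = 1 := by
  rw [RCLike.norm_conj]; exact norm_exp_ofReal_mul_I t

lemma HasDeg.dir1 {c : ℂ} (hc : c ≠ 0) : HasDeg (fun p => c * exp (p.1 * I)) 1 0 := by
  refine ⟨fun p => log c + p.1 * I, by fun_prop, fun p => ?_, fun s t => ?_, fun s t => ?_⟩
  · rw [exp_add, exp_log hc]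
  · push_cast; ring
  · push_cast; ring

lemma HasDeg.dir2 {c : ℂ} (hc : c ≠ 0) : HasDeg (fun p => c * exp (p.2 * I)) 0 1 := by
  refine ⟨fun p => log c + p.2 * I, by fun_prop, fun p => ?_, fun s t => ?_, fun s t => ?_⟩
  · rw [exp_add, exp_log hc]
  · push_cast; ring
  · push_cast; ring

lemma conj_exp (t : ℝ) : (starRingEnd ℂ) (exp (t * I)) = exp (-(t * I)) := by
  rw [← exp_conj]; simp

lemma HasDeg.dir2' {c : ℂ} (hc : c ≠ 0) :
    HasDeg (fun p => c * (starRingEnd ℂ) (exp (p.2 * I))) 0 (-1) := by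
  refine ⟨fun p => log c + -(p.2 * I), by fun_prop, fun p => ?_, fun s t => ?_, fun s t => ?_⟩
  · rw [exp_add, exp_log hc, ← conj_exp]
  · push_cast; ring
  · push_cast; ring

lemma slit_of_norm {a b : ℂ} (h : ‖a - b‖ < ‖b‖) : a / b ∈ slitPlane := by
  have hb : b ≠ 0 := by rintro rfl; simp at h; linarith [norm_nonneg a]
  have : ‖a / b - 1‖ < 1 := by
    rw [← div_self hb, ← sub_div, norm_div, div_lt_one (norm_pos_iff.2 hb)]; exact h
  left
  have h2 := (abs_re_le_norm (a / b - 1)).trans_lt this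
  rw [abs_lt] at h2
  simp at h2
  linarith

def Eps (A B : Fin 6 → ℂ) (e : ℝ) : Prop :=
  0 < e ∧ e < 1 ∧ ∀ i j, i ≠ j → e < |‖A i - A j‖ - ‖B i - B j‖|

lemma exists_eps {A B : Fin 6 → ℂ} (h : ∀ i j, i ≠ j → normSq (A i - A j) ≠ normSq (B i - B j)) :
    ∃ e, Eps A B e := by
  have h1 : ∀ q : Fin 6 × Fin 6, ∃ d : ℝ, 0 < d ∧ (q.1 ≠ q.2 →
      d ≤ |‖A q.1 - A q.2‖ - ‖B q.1 - B q.2‖|) := by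
    intro q
    by_cases hq : q.1 = q.2
    · exact ⟨1, one_pos, fun h => absurd hq h⟩
    · refine ⟨_, ?_, fun _ => le_rfl⟩
      rw [abs_pos, sub_ne_zero]
      intro he
      apply h _ _ hq
      rw [normSq_eq_norm_sq, normSq_eq_norm_sq, he]
  choose d d0 hd using h1
  obtain ⟨q0, hq0⟩ := Finite.exists_min d
  refine ⟨min (d q0) 1 / 2, by have := d0 q0; positivity, ?_, fun i j hij => ?_⟩
  · linarith [min_le_right (d q0) 1]
  · have h2 := hd (i, j) hij
    have h3 := hq0 (i, j)
    have h4 := min_le_left (d q0) 1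
    have h5 := d0 q0
    have : 0 < min (d q0) 1 := by positivity
    simp only at h2
    linarith

lemma deg_tor_self (A B : Fin 6 → ℂ) {e : ℝ} (he : Eps A B e) (i : Fin 6) :
    HasDeg (fun p => phi A B i (tor A B e i p)) 1 0 := by
  have : (fun p => phi A B i (tor A B e i p)) = fun p : ℝ × ℝ => (e : ℂ) * exp (p.1 * I) := by
    funext p; rw [phi_tor]; ring
  rw [this]
  exact HasDeg.dir1 (by exact_mod_cast he.1.ne')

lemma deg_tor_ne (A B : Fin 6 → ℂ) {e : ℝ} (he : Eps A B e) (i j : Fin 6) (hij : i ≠ j) :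
    HasDeg (fun p => phi A B j (tor A B e i p)) 0 (lk A B i j) := by
  have h1 := he.2.2 i j hij
  have cF : Continuous (fun p => phi A B j (tor A B e i p)) := (phi_cont A B j).comp (tor_cont A B e i)
  have pF : Per (fun p => phi A B j (tor A B e i p)) := (tor_per A B e i).comp _
  have hE : ∀ p : ℝ × ℝ, ‖(e : ℂ) * exp (p.1 * I)‖ = e := fun p => by
    rw [norm_mul, norm_exp_ofReal_mul_I, norm_real, Real.norm_of_nonneg he.1.le, mul_one]
  have cc : Continuous (starRingEnd ℂ) := continuous_conj
  unfold lk
  split_ifs with hlk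
  · have h2 : ‖B i - B j‖ < ‖A i - A j‖ := by
      rw [normSq_eq_norm_sq, normSq_eq_norm_sq] at hlk
      exact lt_of_pow_lt_pow_left₀ 2 (norm_nonneg _) hlk
    rw [abs_of_pos (by linarith)] at h1
    have hA : A i - A j ≠ 0 := norm_pos_iff.1 (lt_of_le_of_lt (norm_nonneg _) h2)
    refine HasDeg.of_slit cF (G := fun p => (A i - A j) * exp (p.2 * I)) (by fun_prop) pF ?_
      (fun p => mul_ne_zero hA (exp_ne_zero _)) (fun p => ?_) (HasDeg.dir2 hA)
    · constructor
      · intro s t; rfl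
      · intro s t; simp only [exp_per]
    · apply slit_of_norm
      rw [phi_tor]
      have : ∀ a b c : ℂ, a + b + c - a = b + c := fun a b c => by ring
      rw [this]
      refine (norm_add_le _ _).trans_lt ?_
      rw [hE, norm_mul, norm_conj_exp, norm_mul, norm_exp_ofReal_mul_I]
      linarith
  · have h2 : ‖A i - A j‖ ≤ ‖B i - B j‖ := by
      rw [normSq_eq_norm_sq, normSq_eq_norm_sq] at hlk
      exact (pow_le_pow_iff_left₀ (norm_nonneg _) (norm_nonneg _) two_ne_zero).1 (not_lt.1 hlk)
    rw [abs_of_nonpos (by linarith)] at h1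
    have hB : B i - B j ≠ 0 := norm_pos_iff.1 (by linarith [norm_nonneg (A i - A j), he.1])
    refine HasDeg.of_slit cF (G := fun p => (B i - B j) * (starRingEnd ℂ) (exp (p.2 * I))) (by fun_prop) pF ?_
      (fun p => mul_ne_zero hB ?_) (fun p => ?_) (HasDeg.dir2' hB)
    · constructor
      · intro s t; rfl
      · intro s t; simp only [exp_per]
    · rw [conj_exp]; exact exp_ne_zero _
    · apply slit_of_norm
      rw [phi_tor]
      have : ∀ a b c : ℂ, a + b + c - b = a + c := fun a b c => by ring
      rw [this]
      refine (norm_add_le _ _).trans_lt ?_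
      rw [hE, norm_mul, norm_mul, norm_conj_exp, norm_exp_ofReal_mul_I]
      linarith

lemma HasDeg.ne {F : ℝ × ℝ → ℂ} {m n : ℤ} (h : HasDeg F m n) (p : ℝ × ℝ) : F p ≠ 0 := by
  obtain ⟨h, ch, eh, _⟩ := h
  rw [eh]; exact exp_ne_zero _

lemma tor_mem (A B : Fin 6 → ℂ) {e : ℝ} (he : Eps A B e) (i : Fin 6) (p : ℝ × ℝ) :
    tor A B e i p ∈ XX A B := by
  intro j
  by_cases hij : i = j
  · subst hij; exact (deg_tor_self A B he i).ne p
  · exact (deg_tor_ne A B he i j hij).ne p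

noncomputable def torX (A B : Fin 6 → ℂ) {e : ℝ} (he : Eps A B e) (i : Fin 6) (p : ℝ × ℝ) : XX A B :=
  ⟨tor A B e i p, tor_mem A B he i p⟩

lemma torX_cont (A B : Fin 6 → ℂ) {e : ℝ} (he : Eps A B e) (i : Fin 6) :
    Continuous (torX A B he i) := (tor_cont A B e i).subtype_mk _

lemma torX_per (A B : Fin 6 → ℂ) {e : ℝ} (he : Eps A B e) (i : Fin 6) :
    Per (torX A B he i) :=
  ⟨fun s t => Subtype.ext ((tor_per A B e i).1 s t), fun s t => Subtype.ext ((tor_per A B e i).2 s t)⟩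

/-- full linking matrix row, zero diagonal -/
noncomputable def lam (A B : Fin 6 → ℂ) (i : Fin 6) (b : Fin 6 → ℤ) : ℤ :=
  ∑ j, if j = i then 0 else lk A B i j * b j

lemma deg_tor_prod (A B : Fin 6 → ℂ) {e : ℝ} (he : Eps A B e) (i : Fin 6) (b : Fin 6 → ℤ) :
    HasDeg (fun p => ∏ k, phi A B k (torX A B he i p) ^ b k) (b i) (lam A B i b) := by
  have := HasDeg.prod Finset.univ (F := fun k p => phi A B k (torX A B he i p) ^ b k)
    (m := fun k => if k = i then b k else 0) (n := fun k => if k = i then 0 else lk A B i k * b k)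
    (fun k => by
      by_cases hk : k = i
      · subst hk
        have := (deg_tor_self A B he k).zpow (b k)
        simpa [torX] using this
      · have := (deg_tor_ne A B he i k (Ne.symm hk)).zpow (b k)
        simp only [hk, if_false, mul_zero] at this ⊢
        rw [mul_comm]; exact this)
  simpa [lam] using this

lemma liftsOn_glue {E : Type*} [TopologicalSpace E] {x : E → ℂ} {U V : Set E}
    (hU : IsOpen U) (hV : IsOpen V) {h k : E → ℂ} (ch : ContinuousOn h U) (ck : ContinuousOn k V)
    (eh : ∀ p ∈ U, x p = exp (h p)) (ek : ∀ p ∈ V, x p = exp (k p))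
    (hk : ∀ p ∈ U ∩ V, h p = k p) : LiftsOn x (U ∪ V) := by
  classical
  have e1 : ∀ p ∈ U, (if p ∈ U then h p else k p) = h p := fun p hp => by simp [hp]
  have e2 : ∀ p ∈ V, (if p ∈ U then h p else k p) = k p := fun p hp => by
    by_cases hpU : p ∈ U
    · simp [hpU, hk p ⟨hpU, hp⟩]
    · simp [hpU]
  refine ⟨fun p => if p ∈ U then h p else k p, ?_, ?_⟩
  · exact ContinuousOn.union_of_isOpen (ch.congr e1) (ck.congr e2) hU hV
  · rintro p (hp | hp)
    · beta_reduce; rw [e1 p hp, eh p hp]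
    · beta_reduce; rw [e2 p hp, ek p hp]

lemma half_open (f : ℂ × ℂ →L[ℝ] ℝ) : IsOpen {p | 0 < f p} :=
  isOpen_lt continuous_const f.continuous

lemma half_convex (f : ℂ × ℂ →L[ℝ] ℝ) : Convex ℝ {p | 0 < f p} :=
  convex_halfSpace_gt f.toLinearMap.isLinear 0

lemma liftsOn_ring {x : ℂ × ℂ → ℂ} {C : Set (ℂ × ℂ)} (oC : IsOpen C) (hC : Convex ℝ C)
    (f : ℂ × ℂ →L[ℝ] ℂ) (cx : ContinuousOn x (C ∩ {p | f p ≠ 0}))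
    (nx : ∀ p ∈ C ∩ {p | f p ≠ 0}, x p ≠ 0)
    {γ : ℝ → ℂ × ℂ} (cγ : Continuous γ) (hγ : ∀ s, γ s ∈ C) {e : ℝ} (he : 0 < e)
    (fγ : ∀ s, f (γ s) = e * exp (s * I)) (pγ : ∀ s, γ (s + 2 * Real.pi) = γ s)
    {l : ℝ → ℂ} (cl : Continuous l) (pl : ∀ s, l (s + 2 * Real.pi) = l s)
    (el : ∀ s, x (γ s) = exp (l s)) : LiftsOn x (C ∩ {p | f p ≠ 0}) := by
  have main : ∀ g : ℂ × ℂ →L[ℝ] ℝ, (∀ p, g p ≠ 0 → f p ≠ 0) → LiftsOn x (C ∩ {p | 0 < g p}) := by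
    intro g hg
    have : C ∩ {p | 0 < g p} ⊆ C ∩ {p | f p ≠ 0} := fun p hp => ⟨hp.1, hg p (ne_of_gt hp.2)⟩
    exact liftsOn_convex (oC.inter (half_open g)) (hC.inter (half_convex g)) (cx.mono this)
      (fun p hp => nx p (this hp))
  let R : ℂ × ℂ →L[ℝ] ℝ := reCLM.comp f
  let J : ℂ × ℂ →L[ℝ] ℝ := imCLM.comp f
  have hR : ∀ p, R p = (f p).re := fun p => rfl
  have hJ : ∀ p, J p = (f p).im := fun p => rfl
  have l1 := main R (fun p hp h => hp (by rw [hR, h]; rfl))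
  have l2 := main J (fun p hp h => hp (by rw [hJ, h]; rfl))
  have l3 := main (-R) (fun p hp h => hp (by
    show -R p = 0
    rw [hR, h]; simp))
  have l4 := main (-J) (fun p hp h => hp (by
    show -J p = 0
    rw [hJ, h]; simp))
  have o1 := oC.inter (half_open R)
  have o2 := oC.inter (half_open J)
  have o3 := oC.inter (half_open (-R))
  have o4 := oC.inter (half_open (-J))
  have l12 := liftsOn_union o1 o2 l1 l2 (by
    apply Convex.isPreconnected
    exact (hC.inter (half_convex R)).inter (hC.inter (half_convex J)))
  have l123 := liftsOn_union (o1.union o2) o3 l12 l3 (by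
    have : ((C ∩ {p | 0 < R p}) ∪ (C ∩ {p | 0 < J p})) ∩ (C ∩ {p | 0 < (-R) p}) =
        (C ∩ {p | 0 < J p}) ∩ (C ∩ {p | 0 < (-R) p}) := by
      ext p
      simp only [mem_inter_iff, mem_union, mem_ofPred_eq, neg_apply]
      constructor
      · rintro ⟨h | h, h'⟩
        · linarith [h.2, h'.2]
        · exact ⟨h, h'⟩
      · rintro ⟨h, h'⟩; exact ⟨Or.inr h, h'⟩
    rw [this]
    apply Convex.isPreconnected
    exact (hC.inter (half_convex J)).inter (hC.inter (half_convex (-R))))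
  obtain ⟨h, ch, eh⟩ := l123
  obtain ⟨k, ck, ek⟩ := l4
  -- offsets
  obtain ⟨n, hn⟩ := const_diff (S := (C ∩ {p | 0 < (-J) p}) ∩ (C ∩ {p | 0 < R p}))
    ((hC.inter (half_convex (-J))).inter (hC.inter (half_convex R))).isPreconnected
    (h₁ := h) (h₂ := k) (ch.mono fun p hp => Or.inl (Or.inl hp.2)) (ck.mono fun p hp => hp.1)
    (fun p hp => by rw [← eh p (Or.inl (Or.inl hp.2)), ← ek p hp.1])
  obtain ⟨n', hn'⟩ := const_diff (S := (C ∩ {p | 0 < (-J) p}) ∩ (C ∩ {p | 0 < (-R) p}))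
    ((hC.inter (half_convex (-J))).inter (hC.inter (half_convex (-R)))).isPreconnected
    (h₁ := h) (h₂ := k) (ch.mono fun p hp => Or.inr hp.2) (ck.mono fun p hp => hp.1)
    (fun p hp => by rw [← eh p (Or.inr hp.2), ← ek p hp.1])
  have gR : ∀ s, R (γ s) = e * Real.cos s := fun s => by
    rw [hR, fγ, exp_mul_I]; simp [cos_ofReal_re, sin_ofReal_im]
  have gJ : ∀ s, J (γ s) = e * Real.sin s := fun s => by
    rw [hJ, fγ, exp_mul_I]; simp [cos_ofReal_im, sin_ofReal_re]
  have pi := Real.pi_pos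
  -- on the arcs
  have arc1 : ∀ s ∈ Icc (-(Real.pi / 4)) (5 * Real.pi / 4), γ s ∈ ((C ∩ {p | 0 < R p}) ∪ (C ∩ {p | 0 < J p})) ∪
      (C ∩ {p | 0 < (-R) p}) := by
    intro s hs
    by_cases h1 : 0 < Real.cos s
    · exact Or.inl (Or.inl ⟨hγ s, by show 0 < R (γ s); rw [gR]; positivity⟩)
    by_cases h2 : Real.cos s < 0
    · refine Or.inr ⟨hγ s, ?_⟩
      show 0 < - R (γ s)
      rw [gR]; nlinarith
    · refine Or.inl (Or.inr ⟨hγ s, ?_⟩)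
      show 0 < J (γ s)
      rw [gJ]
      have hs0 : 0 < Real.sin s := by
        apply Real.sin_pos_of_pos_of_lt_pi
        · by_contra hh
          exact h1 (Real.cos_pos_of_mem_Ioo ⟨by linarith [hs.1], by linarith⟩)
        · by_contra hh
          exact h2 (Real.cos_neg_of_pi_div_two_lt_of_lt (by linarith) (by linarith [hs.2]))
      positivity
  have arc2 : ∀ s ∈ Icc (5 * Real.pi / 4) (7 * Real.pi / 4), γ s ∈ C ∩ {p | 0 < (-J) p} := by
    intro s hs
    refine ⟨hγ s, ?_⟩
    show 0 < - J (γ s)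
    rw [gJ]
    have hs0 : Real.sin (s - 2 * Real.pi) < 0 :=
      Real.sin_neg_of_neg_of_neg_pi_lt (by linarith [hs.2]) (by linarith [hs.1])
    rw [Real.sin_sub_two_pi] at hs0
    nlinarith
  obtain ⟨c, hc⟩ := const_diff (S := Icc (-(Real.pi / 4)) (5 * Real.pi / 4)) isPreconnected_Icc
    (h₁ := fun s => h (γ s)) (h₂ := l) (ch.comp cγ.continuousOn arc1) cl.continuousOn
    (fun s hs => by rw [← eh _ (arc1 s hs), el])
  obtain ⟨d, hd⟩ := const_diff (S := Icc (5 * Real.pi / 4) (7 * Real.pi / 4)) isPreconnected_Icc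
    (h₁ := fun s => k (γ s)) (h₂ := l) (ck.comp cγ.continuousOn arc2) cl.continuousOn
    (fun s hs => by rw [← ek _ (arc2 s hs), el])
  have sA : (5 * Real.pi / 4) ∈ Icc (-(Real.pi / 4)) (5 * Real.pi / 4) := ⟨by linarith, le_rfl⟩
  have sB : (5 * Real.pi / 4) ∈ Icc (5 * Real.pi / 4) (7 * Real.pi / 4) := ⟨le_rfl, by linarith⟩
  have sC : -(Real.pi / 4) ∈ Icc (-(Real.pi / 4)) (5 * Real.pi / 4) := ⟨le_rfl, by linarith⟩
  have sD : (7 * Real.pi / 4) ∈ Icc (5 * Real.pi / 4) (7 * Real.pi / 4) := ⟨by linarith, le_rfl⟩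
  have eCD : (7 * Real.pi / 4) = -(Real.pi / 4) + 2 * Real.pi := by ring
  have k1 := hc _ sA
  have k2 := hd _ sB
  have k3 := hc _ sC
  have k4 := hd _ sD
  have memA : γ (5 * Real.pi / 4) ∈ (C ∩ {p | 0 < (-J) p}) ∩ (C ∩ {p | 0 < (-R) p}) := by
    refine ⟨arc2 _ sB, hγ _, ?_⟩
    show 0 < - R _
    rw [gR]
    have : Real.cos (5 * Real.pi / 4) < 0 :=
      Real.cos_neg_of_pi_div_two_lt_of_lt (by linarith) (by linarith)
    nlinarith
  have memC : γ (-(Real.pi / 4)) ∈ (C ∩ {p | 0 < (-J) p}) ∩ (C ∩ {p | 0 < R p}) := by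
    have h1 := arc2 _ sD
    rw [eCD, pγ] at h1
    refine ⟨h1, hγ _, ?_⟩
    show 0 < R _
    rw [gR]
    have : 0 < Real.cos (-(Real.pi / 4)) :=
      Real.cos_pos_of_mem_Ioo ⟨by linarith, by linarith⟩
    positivity
  have k5 := hn' _ memA
  have k6 := hn _ memC
  simp only [eCD, pγ, pl] at k1 k2 k3 k4
  have hnn : (n : ℂ) = n' := by
    have : (n : ℂ) * (2 * Real.pi * I) = n' * (2 * Real.pi * I) := by
      linear_combination -k1 + k2 + k3 - k4 + k5 - k6
    exact mul_right_cancel₀ two_pi_I_ne_zero this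
  have fin := liftsOn_glue ((o1.union o2).union o3) o4 ch (k := fun p => k p + n * (2 * Real.pi * I))
    (ck.add continuousOn_const) eh (fun p hp => by
      rw [exp_add, exp_int_mul_two_pi_mul_I, mul_one]; exact ek p hp) (by
      rintro p ⟨(hp | hp) | hp, hp4⟩
      · exact hn p ⟨hp4, hp⟩
      · have h1 : 0 < J p := hp.2
        have h2 : 0 < - J p := hp4.2
        linarith
      · show h p = k p + _
        rw [hnn]; exact hn' p ⟨hp4, hp⟩)
  convert fin using 1
  ext p
  simp only [mem_inter_iff, mem_union, mem_ofPred_eq, neg_apply, hR, hJ]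
  constructor
  · rintro ⟨h1, h2⟩
    by_contra hcon
    apply h2
    apply Complex.ext
    · simp only [zero_re]; by_contra h3
      rcases lt_or_gt_of_ne h3 with h3 | h3
      · exact hcon (Or.inl (Or.inr ⟨h1, by linarith⟩))
      · exact hcon (Or.inl (Or.inl (Or.inl ⟨h1, h3⟩)))
    · simp only [zero_im]; by_contra h3
      rcases lt_or_gt_of_ne h3 with h3 | h3
      · exact hcon (Or.inr ⟨h1, by linarith⟩)
      · exact hcon (Or.inl (Or.inl (Or.inr ⟨h1, h3⟩)))
  · rintro (((h | h) | h) | h)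
    all_goals refine ⟨h.1, fun h0 => ?_⟩; have := h.2; rw [h0] at this; simp at this

/-- extension over a thin closed set -/
lemma liftsOn_extend {E : Type*} [TopologicalSpace E] {x : E → ℂ} {A X : Set E}
    (hAX : A ⊆ X) (cx : ContinuousOn x X) (l : LiftsOn x A)
    (hB : ∀ p ∈ X, p ∉ A → ∃ B, IsOpen B ∧ p ∈ B ∧ LiftsOn x B ∧ IsPreconnected (B ∩ A))
    (hcl : X ⊆ closure A) : LiftsOn x X := by
  obtain ⟨h, ch, eh⟩ := l
  have lim : ∀ p ∈ X, ∃ y, Filter.Tendsto h (𝓝[A] p) (𝓝 y) := by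
    intro p hp
    by_cases hpA : p ∈ A
    · exact ⟨h p, ch p hpA⟩
    · obtain ⟨B, oB, pB, ⟨k, ck, ek⟩, hc⟩ := hB p hp hpA
      obtain ⟨n, hn⟩ := const_diff hc (h₁ := h) (h₂ := k) (ch.mono fun p hp => hp.2)
        (ck.mono fun p hp => hp.1) (fun p hp => by rw [← eh p hp.2, ← ek p hp.1])
      refine ⟨k p + n * (2 * Real.pi * I), ?_⟩
      have h1 : Filter.Tendsto (fun q => k q + n * (2 * Real.pi * I)) (𝓝[A] p)
          (𝓝 (k p + n * (2 * Real.pi * I))) := by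
        have : ContinuousAt k p := ck.continuousAt (oB.mem_nhds pB)
        exact ((this.tendsto.mono_left nhdsWithin_le_nhds).add tendsto_const_nhds)
      refine h1.congr' ?_
      filter_upwards [self_mem_nhdsWithin, mem_nhdsWithin_of_mem_nhds (oB.mem_nhds pB)] with q hq hq'
      exact (hn q ⟨hq', hq⟩).symm
  refine ⟨extendFrom A h, continuousOn_extendFrom hcl lim, fun p hp => ?_⟩
  have h1 := tendsto_extendFrom (lim p hp)
  have h2 : Filter.Tendsto x (𝓝[A] p) (𝓝 (x p)) := (cx p hp).mono_left (nhdsWithin_mono _ hAX)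
  have h3 : Filter.Tendsto (fun q => exp (h q)) (𝓝[A] p) (𝓝 (exp (extendFrom A h p))) :=
    (continuous_exp.tendsto _).comp h1
  have h4 : Filter.Tendsto (fun q => exp (h q)) (𝓝[A] p) (𝓝 (x p)) := by
    refine h2.congr' ?_
    filter_upwards [self_mem_nhdsWithin] with q hq using eh q hq
  have : (𝓝[A] p).NeBot := mem_closure_iff_nhdsWithin_neBot.1 (hcl hp)
  exact tendsto_nhds_unique h4 h3

noncomputable def AK : Fin 6 → ℂ :=
  ![(5 - 5 * I) / 2, (7 - 10 * I) / 2, (5 - 14 * I) / 2, (7 - 9 * I) / 2, 6, 7]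
noncomputable def BK : Fin 6 → ℂ :=
  ![-((3 - 5 * I) / 2), -((3 - 10 * I) / 2), (3 + 14 * I) / 2, (3 + 9 * I) / 2, 0, 0]

def al : Fin 6 → ℝ := ![1, 2, 4, 5, 6, 7]
def be : Fin 6 → ℝ := ![4, 5, 1, 2, 6, 7]
def cc : Fin 6 → ℝ := ![5, 10, 14, 9, 0, 0]

lemma phiK_re (k : Fin 6) (p : ℂ × ℂ) :
    (phi AK BK k p).re = p.1.re - al k * p.2.re - cc k * p.2.im := by
  fin_cases k <;> simp [phi, AK, BK, al, cc] <;> ring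

lemma phiK_im (k : Fin 6) (p : ℂ × ℂ) :
    (phi AK BK k p).im = p.1.im - be k * p.2.im := by
  fin_cases k <;> simp [phi, AK, BK, be] <;> ring

noncomputable def phiL (A B : Fin 6 → ℂ) (k : Fin 6) : ℂ × ℂ →L[ℝ] ℂ :=
  LinearMap.toContinuousLinearMap
    { toFun := phi A B k
      map_add' := fun p q => by simp [phi]; ring
      map_smul' := fun r p => by simp [phi]; ring }

lemma phiL_apply (A B : Fin 6 → ℂ) (k : Fin 6) (p : ℂ × ℂ) : phiL A B k p = phi A B k p := rfl

lemma phi_neg (A B : Fin 6 → ℂ) (k : Fin 6) (p : ℂ × ℂ) : phi A B k (-p) = - phi A B k p := by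
  simp [phi]; ring

lemma XX_open (A B : Fin 6 → ℂ) : IsOpen (XX A B) := by
  have : XX A B = ⋂ k, {p | phi A B k p ≠ 0} := by
    ext p; simp [XX]
  rw [this]
  exact isOpen_iInter_of_finite fun k => isOpen_ne_fun (phi_cont A B k) continuous_const

noncomputable def fv : ℂ × ℂ →L[ℝ] ℝ := imCLM.comp (ContinuousLinearMap.fst ℝ ℂ ℂ)
noncomputable def fy : ℂ × ℂ →L[ℝ] ℝ := imCLM.comp (ContinuousLinearMap.snd ℝ ℂ ℂ)

def DD (a c : ℝ) : Set (ℂ × ℂ) := {p | 0 < p.2.im ∧ a * p.2.im < p.1.im ∧ p.1.im < c * p.2.im}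

lemma DD_eq (a c : ℝ) : DD a c = {p | 0 < fy p} ∩ ({p | 0 < (fv - a • fy) p} ∩ {p | 0 < (c • fy - fv) p}) := by
  ext p
  simp [DD, fv, fy]

lemma DD_open (a c : ℝ) : IsOpen (DD a c) := by
  rw [DD_eq]
  exact (half_open _).inter ((half_open _).inter (half_open _))

lemma DD_convex (a c : ℝ) : Convex ℝ (DD a c) := by
  rw [DD_eq]
  exact (half_convex _).inter ((half_convex _).inter (half_convex _))

lemma tor_half (A B : Fin 6 → ℂ) (e : ℝ) (k : Fin 6) (s : ℝ) :
    (tor A B e k (s, Real.pi / 2)).2 = I := by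
  simp only [tor]
  push_cast
  exact exp_pi_div_two_mul_I

lemma phiK_half (e : ℝ) (k : Fin 6) (s : ℝ) :
    phi AK BK k (tor AK BK e k (s, Real.pi / 2)) = e * exp (s * I) := by
  rw [phi_tor]; ring

lemma lifts_one {x : ℂ × ℂ → ℂ} (cx : ContinuousOn x (XX AK BK)) (nx : ∀ p ∈ XX AK BK, x p ≠ 0)
    {e : ℝ} (he0 : 0 < e) (he1 : e < 1) (k : Fin 6) {l : ℝ → ℂ} (cl : Continuous l)
    (pl : ∀ s, l (s + 2 * Real.pi) = l s)
    (el : ∀ s, x (tor AK BK e k (s, Real.pi / 2)) = exp (l s)) (a c : ℝ)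
    (ha : a ≤ be k - 1) (hc : be k + 1 ≤ c) (hj : ∀ j, j ≠ k → be j ≤ a ∨ c ≤ be j) :
    LiftsOn x (DD a c ∩ XX AK BK) := by
  have e1 : DD a c ∩ XX AK BK = DD a c ∩ {p | phiL AK BK k p ≠ 0} := by
    ext p
    constructor
    · rintro ⟨h1, h2⟩; exact ⟨h1, h2 k⟩
    · rintro ⟨h1, h2⟩
      refine ⟨h1, fun j => ?_⟩
      by_cases hjk : j = k
      · rw [hjk]; exact h2
      · intro h0
        have := phiK_im j p
        rw [h0] at this
        simp only [zero_im] at this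
        obtain ⟨h3, h4, h5⟩ := h1
        rcases hj j hjk with h | h
        · nlinarith
        · nlinarith
  have sub : DD a c ∩ {p | phiL AK BK k p ≠ 0} ⊆ XX AK BK := e1 ▸ inter_subset_right
  rw [e1]
  refine liftsOn_ring (DD_open a c) (DD_convex a c) (phiL AK BK k) (cx.mono sub)
    (fun p hp => nx p (sub hp)) (γ := fun s => tor AK BK e k (s, Real.pi / 2))
    ((tor_cont AK BK e k).comp (by fun_prop)) (fun s => ?_) he0 (fun s => phiK_half e k s)
    (fun s => (tor_per AK BK e k).1 _ _) cl pl el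
  have h2 := tor_half AK BK e k s
  have h3 := phiK_im k (tor AK BK e k (s, Real.pi / 2))
  rw [phiK_half, h2] at h3
  have h4 : ((e : ℂ) * exp (s * I)).im = e * Real.sin s := by
    rw [exp_mul_I]; simp [cos_ofReal_im, sin_ofReal_re]
  rw [h4] at h3
  have h5 := Real.sin_le_one s
  have h6 := Real.neg_one_le_sin s
  refine ⟨?_, ?_, ?_⟩
  · simp only [h2, I_im]; norm_num
  · simp only [h2, I_im] at *; nlinarith
  · simp only [h2, I_im] at *; nlinarith

lemma DD_step {x : ℂ × ℂ → ℂ} {a b c : ℝ} (ha : -1 ≤ a) (hab : a < b) (hbc : b ≤ c)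
    (h0 : ∀ j, be j ≤ a ∨ b ≤ be j)
    (h1 : LiftsOn x (DD (-1) b ∩ XX AK BK)) (h2 : LiftsOn x (DD a c ∩ XX AK BK)) :
    LiftsOn x (DD (-1) c ∩ XX AK BK) := by
  have oX := XX_open AK BK
  have := liftsOn_union ((DD_open (-1) b).inter oX) ((DD_open a c).inter oX) h1 h2 (by
    have : (DD (-1) b ∩ XX AK BK) ∩ (DD a c ∩ XX AK BK) = DD a b := by
      ext p
      constructor
      · rintro ⟨⟨⟨h1, h2, h3⟩, -⟩, ⟨-, h5, h6⟩, -⟩; exact ⟨h1, h5, h3⟩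
      · rintro ⟨h1, h2, h3⟩
        have hX : p ∈ XX AK BK := by
          intro j hj
          have := phiK_im j p
          rw [hj] at this
          simp only [zero_im] at this
          rcases h0 j with h | h
          · nlinarith
          · nlinarith
        exact ⟨⟨⟨h1, by nlinarith, h3⟩, hX⟩, ⟨h1, h2, by nlinarith⟩, hX⟩
    rw [this]
    exact (DD_convex a b).isPreconnected)
  convert this using 1
  ext p
  constructor
  · rintro ⟨⟨h1, h2, h3⟩, h4⟩
    by_cases hp : p.1.im < b * p.2.im
    · exact Or.inl ⟨⟨h1, h2, hp⟩, h4⟩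
    · exact Or.inr ⟨⟨h1, by nlinarith, h3⟩, h4⟩
  · rintro (⟨⟨h1, h2, h3⟩, h4⟩ | ⟨⟨h1, h2, h3⟩, h4⟩)
    · exact ⟨⟨h1, h2, by nlinarith⟩, h4⟩
    · exact ⟨⟨h1, by nlinarith, h3⟩, h4⟩

lemma lifts_Mpos {x : ℂ × ℂ → ℂ} (cx : ContinuousOn x (XX AK BK)) (nx : ∀ p ∈ XX AK BK, x p ≠ 0)
    {e : ℝ} (he0 : 0 < e) (he1 : e < 1)
    (H : ∀ k, ∃ l : ℝ → ℂ, Continuous l ∧ (∀ s, l (s + 2 * Real.pi) = l s) ∧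
      ∀ s, x (tor AK BK e k (s, Real.pi / 2)) = exp (l s)) :
    LiftsOn x (DD (-1) 10 ∩ XX AK BK) := by
  have one : ∀ (k : Fin 6) (a c : ℝ) (ha : a ≤ be k - 1) (hc : be k + 1 ≤ c)
    (hj : ∀ j, j ≠ k → be j ≤ a ∨ c ≤ be j), LiftsOn x (DD a c ∩ XX AK BK) := by
    intro k a c ha hc hj
    obtain ⟨l, cl, pl, el⟩ := H k
    exact lifts_one cx nx he0 he1 k cl pl el a c ha hc hj
  have L1 := one 2 (-1) 2 (by simp [be] <;> norm_num) (by simp [be] <;> norm_num)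
    (by intro j; fin_cases j <;> simp [be] <;> norm_num)
  have L2 := DD_step (a := 1) (b := 2) (c := 4) (by norm_num) (by norm_num) (by norm_num)
    (by intro j; fin_cases j <;> simp [be] <;> norm_num) L1
    (one 3 _ _ (by simp [be] <;> norm_num) (by simp [be] <;> norm_num) (by intro j; fin_cases j <;> simp [be] <;> norm_num))
  have L3 := DD_step (a := 2) (b := 4) (c := 5) (by norm_num) (by norm_num) (by norm_num)
    (by intro j; fin_cases j <;> simp [be] <;> norm_num) L2
    (one 0 _ _ (by simp [be] <;> norm_num) (by simp [be] <;> norm_num) (by intro j; fin_cases j <;> simp [be] <;> norm_num))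
  have L4 := DD_step (a := 4) (b := 5) (c := 6) (by norm_num) (by norm_num) (by norm_num)
    (by intro j; fin_cases j <;> simp [be] <;> norm_num) L3
    (one 1 _ _ (by simp [be] <;> norm_num) (by simp [be] <;> norm_num) (by intro j; fin_cases j <;> simp [be] <;> norm_num))
  have L5 := DD_step (a := 5) (b := 6) (c := 7) (by norm_num) (by norm_num) (by norm_num)
    (by intro j; fin_cases j <;> simp [be] <;> norm_num) L4
    (one 4 _ _ (by simp [be] <;> norm_num) (by simp [be] <;> norm_num) (by intro j; fin_cases j <;> simp [be] <;> norm_num))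
  exact DD_step (a := 6) (b := 7) (c := 10) (by norm_num) (by norm_num) (by norm_num)
    (by intro j; fin_cases j <;> simp [be] <;> norm_num) L5
    (one 5 _ _ (by simp [be] <;> norm_num) (by simp [be] <;> norm_num) (by intro j; fin_cases j <;> simp [be] <;> norm_num))

lemma ball_conn (p : ℂ × ℂ) (h1 : p.1.im = 0) (h2 : p.2.im = 0) {r : ℝ} (hr : 0 < r) :
    IsPreconnected (Metric.ball p r ∩ {q | q.1.im ≠ 0 ∨ q.2.im ≠ 0}) := by
  have hb := convex_ball p r
  have c1 := (hb.inter (half_convex fv)).isPreconnected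
  have c2 := (hb.inter (half_convex fy)).isPreconnected
  have c3 := (hb.inter (half_convex (-fv))).isPreconnected
  have c4 := (hb.inter (half_convex (-fy))).isPreconnected
  have pt : ∀ a b : ℝ, |a| < r → |b| < r → p + (a * I, b * I) ∈ Metric.ball p r := by
    intro a b ha hb
    rw [mem_ball_iff_norm]
    simp only [add_sub_cancel_left]
    rw [Prod.norm_def, max_lt_iff]
    simp [ha, hb]
  have r2 : |r / 2| < r := by rw [abs_of_pos (by linarith)]; linarith
  have r2' : |-(r / 2)| < r := by rw [abs_neg]; exact r2
  have q1 := pt _ _ r2 r2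
  have q2 := pt _ _ r2' r2
  have q3 := pt _ _ r2' r2'
  have i12 := IsPreconnected.union (p + (((r / 2 : ℝ) : ℂ) * I, ((r / 2 : ℝ) : ℂ) * I))
    (by exact ⟨q1, by simp [fv, h1, hr]⟩) (by exact ⟨q1, by simp [fy, h2, hr]⟩) c1 c2
  have i123 := IsPreconnected.union (p + (((-(r / 2) : ℝ) : ℂ) * I, ((r / 2 : ℝ) : ℂ) * I))
    (by exact Or.inr ⟨q2, by simp [fy, h2, hr]⟩) (by exact ⟨q2, by simp [fv, h1, hr]⟩) i12 c3
  have i1234 := IsPreconnected.union (p + (((-(r / 2) : ℝ) : ℂ) * I, ((-(r / 2) : ℝ) : ℂ) * I))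
    (by exact Or.inr ⟨q3, by simp [fv, h1, hr]⟩) (by exact ⟨q3, by simp [fy, h2, hr]⟩) i123 c4
  convert i1234 using 1
  ext q
  simp only [mem_inter_iff, mem_union, mem_ofPred_eq, neg_apply]
  have e1 : fv q = q.1.im := rfl
  have e2 : fy q = q.2.im := rfl
  rw [e1, e2]
  simp only [← and_or_left]
  refine and_congr_right fun _ => ?_
  rw [ne_iff_lt_or_gt, ne_iff_lt_or_gt]
  simp only [neg_pos, gt_iff_lt]
  tauto

lemma tor_neg (A B : Fin 6 → ℂ) (e : ℝ) (k : Fin 6) (s t : ℝ) :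
    -tor A B e k (s, t) = tor A B e k (s + Real.pi, t + Real.pi) := by
  have h : ∀ r : ℝ, exp (((r + Real.pi : ℝ) : ℂ) * I) = - exp (r * I) := fun r => by
    push_cast
    rw [add_mul, exp_add, exp_pi_mul_I]; ring
  simp only [tor, h, Prod.neg_mk, map_neg]
  congr 1
  ring

def WW : Set (ℂ × ℂ) := {p | ∀ k, (phi AK BK k p).re < 0}
def RP : Set (ℂ × ℂ) := {p | ∀ k, 0 < (phi AK BK k p).im}
def RN : Set (ℂ × ℂ) := {p | ∀ k, (phi AK BK k p).im < 0}

lemma half_all (f : Fin 6 → ℂ × ℂ →L[ℝ] ℝ) : IsOpen {p | ∀ k, 0 < f k p} ∧ Convex ℝ {p | ∀ k, 0 < f k p} := by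
  have : {p | ∀ k, 0 < f k p} = ⋂ k, {p | 0 < f k p} := by ext p; simp
  rw [this]
  exact ⟨isOpen_iInter_of_finite fun k => half_open (f k), convex_iInter fun k => half_convex (f k)⟩

lemma WW_oc : IsOpen WW ∧ Convex ℝ WW := by
  have := half_all (fun k => -(reCLM.comp (phiL AK BK k)))
  convert this using 2 <;>
  · ext p
    simp [WW, phiL_apply]

lemma RP_oc : IsOpen RP ∧ Convex ℝ RP := by
  have := half_all (fun k => (imCLM.comp (phiL AK BK k)))
  convert this using 2 <;>
  · ext p
    simp [RP, phiL_apply]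

lemma RN_oc : IsOpen RN ∧ Convex ℝ RN := by
  have := half_all (fun k => -(imCLM.comp (phiL AK BK k)))
  convert this using 2 <;>
  · ext p
    simp [RN, phiL_apply]

lemma WW_sub : WW ⊆ XX AK BK := fun p hp k h => by
  have := hp k; rw [h] at this; simp at this
lemma RP_sub : RP ⊆ XX AK BK := fun p hp k h => by
  have := hp k; rw [h] at this; simp at this
lemma RN_sub : RN ⊆ XX AK BK := fun p hp k h => by
  have := hp k; rw [h] at this; simp at this

lemma three_conn {a b c : Set (ℂ × ℂ)} (ha : Convex ℝ a) (hb : Convex ℝ b) (hc : Convex ℝ c)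
    {p q : ℂ × ℂ} (h1 : p ∈ a) (h2 : p ∈ b) (h3 : q ∈ a) (h4 : q ∈ c) : IsPreconnected (a ∪ b ∪ c) :=
  IsPreconnected.union q (Or.inl h3) h4 (IsPreconnected.union p h1 h2 ha.isPreconnected hb.isPreconnected)
    hc.isPreconnected

lemma be_le (k : Fin 6) : 1 ≤ be k ∧ be k ≤ 7 := by
  fin_cases k <;> simp [be] <;> norm_num

lemma alcc (k : Fin 6) : 1 ≤ al k ∧ 0 ≤ cc k ∧ cc k ≤ 14 := by
  fin_cases k <;> simp [al, cc] <;> norm_num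

lemma mk_W (v y : ℝ) (hy : |y| ≤ 1) : ((v * I, 100 + y * I) : ℂ × ℂ) ∈ WW := by
  intro k
  rw [phiK_re]
  obtain ⟨h1, h2, h3⟩ := alcc k
  rw [abs_le] at hy
  simp
  nlinarith

lemma lifts_X {x : ℂ × ℂ → ℂ} (cx : ContinuousOn x (XX AK BK)) (nx : ∀ p ∈ XX AK BK, x p ≠ 0)
    {e : ℝ} (he0 : 0 < e) (he1 : e < 1)
    (H : ∀ k t, ∃ l : ℝ → ℂ, Continuous l ∧ (∀ s, l (s + 2 * Real.pi) = l s) ∧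
      ∀ s, x (tor AK BK e k (s, t)) = exp (l s)) :
    LiftsOn x (XX AK BK) := by
  have oX := XX_open AK BK
  have negX : ∀ p, p ∈ XX AK BK → -p ∈ XX AK BK := fun p hp k h => hp k (by
    rw [phi_neg] at h; simpa using h)
  have oD : IsOpen (DD (-1) 10) := DD_open _ _
  have cD : Convex ℝ (DD (-1) 10) := DD_convex _ _
  have onD : IsOpen ((fun p => -p) ⁻¹' (DD (-1) 10)) := oD.preimage continuous_neg
  have cnD : Convex ℝ ((fun p => -p) ⁻¹' (DD (-1) 10)) := cD.neg
  have lM := lifts_Mpos cx nx he0 he1 (fun k => H k _)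
  have lN : LiftsOn x ((fun p => -p) ⁻¹' (DD (-1) 10) ∩ XX AK BK) := by
    have := lifts_Mpos (x := fun p => x (-p)) (cx.comp continuous_neg.continuousOn negX)
      (fun p hp => nx _ (negX p hp)) he0 he1 (fun k => by
        obtain ⟨l, cl, pl, el⟩ := H k (Real.pi / 2 + Real.pi)
        refine ⟨fun s => l (s + Real.pi), by fun_prop, fun s => ?_, fun s => ?_⟩
        · beta_reduce; rw [← pl (s + Real.pi)]; ring_nf
        · rw [tor_neg, el])
    obtain ⟨h, ch, eh⟩ := this
    refine ⟨fun p => h (-p), ch.comp continuous_neg.continuousOn (fun p hp => ⟨hp.1, negX p hp.2⟩), ?_⟩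
    intro p hp
    have := eh (-p) ⟨hp.1, negX p hp.2⟩
    simpa using this
  have lW := liftsOn_convex WW_oc.1 WW_oc.2 (cx.mono WW_sub) (fun p hp => nx p (WW_sub hp))
  have lRP := liftsOn_convex RP_oc.1 RP_oc.2 (cx.mono RP_sub) (fun p hp => nx p (RP_sub hp))
  have lRN := liftsOn_convex RN_oc.1 RN_oc.2 (cx.mono RN_sub) (fun p hp => nx p (RN_sub hp))
  set D := DD (-1) 10 with hD
  set N := (fun p => -p) ⁻¹' D with hN
  have disjDN : ∀ p, p ∈ D → p ∈ N → False := by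
    rintro p ⟨h1, -⟩ ⟨h2, -⟩
    simp at h2; linarith
  have disjR : ∀ p, p ∈ RP → p ∈ RN → False := fun p h1 h2 => by linarith [h1 0, h2 0]
  have oM := oD.inter oX
  have oN := onD.inter oX
  have L1 := liftsOn_union WW_oc.1 oM lW lM (by
    have : WW ∩ (D ∩ XX AK BK) = WW ∩ D := by
      ext p; exact ⟨fun h => ⟨h.1, h.2.1⟩, fun h => ⟨h.1, h.2, WW_sub h.1⟩⟩
    rw [this]; exact (WW_oc.2.inter cD).isPreconnected)
  have L2 := liftsOn_union (WW_oc.1.union oM) oN L1 lN (by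
    have : (WW ∪ (D ∩ XX AK BK)) ∩ (N ∩ XX AK BK) = WW ∩ N := by
      ext p
      refine ⟨?_, fun h => ⟨Or.inl h.1, h.2, WW_sub h.1⟩⟩
      rintro ⟨h | h, h'⟩
      · exact ⟨h, h'.1⟩
      · exact (disjDN p h.1 h'.1).elim
    rw [this]; exact (WW_oc.2.inter cnD).isPreconnected)
  have L3 := liftsOn_union ((WW_oc.1.union oM).union oN) RP_oc.1 L2 lRP (by
    have : (WW ∪ (D ∩ XX AK BK) ∪ (N ∩ XX AK BK)) ∩ RP = (WW ∩ RP) ∪ (D ∩ RP) ∪ (N ∩ RP) := by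
      ext p
      constructor
      · rintro ⟨(h | h) | h, h'⟩
        · exact Or.inl (Or.inl ⟨h, h'⟩)
        · exact Or.inl (Or.inr ⟨h.1, h'⟩)
        · exact Or.inr ⟨h.1, h'⟩
      · rintro ((h | h) | h)
        · exact ⟨Or.inl (Or.inl h.1), h.2⟩
        · exact ⟨Or.inl (Or.inr ⟨h.1, RP_sub h.2⟩), h.2⟩
        · exact ⟨Or.inr ⟨h.1, RP_sub h.2⟩, h.2⟩
    rw [this]
    have w1 := mk_W 8 1 (by simp)
    have w2 := mk_W 0 (-1) (by simp)
    have r1 : ((((8 : ℝ) : ℂ) * I, 100 + ((1 : ℝ) : ℂ) * I) : ℂ × ℂ) ∈ RP := fun k => by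
      rw [phiK_im]; have := be_le k; simp; linarith
    have r2 : ((((0 : ℝ) : ℂ) * I, 100 + ((-1 : ℝ) : ℂ) * I) : ℂ × ℂ) ∈ RP := fun k => by
      rw [phiK_im]; have := be_le k; simp; linarith
    refine three_conn (WW_oc.2.inter RP_oc.2) (cD.inter RP_oc.2) (cnD.inter RP_oc.2)
      ⟨w1, r1⟩ ⟨?_, r1⟩ ⟨w2, r2⟩ ⟨?_, r2⟩
    · simp [hD, DD]; norm_num
    · simp [hN, hD, DD])
  have L4 := liftsOn_union (((WW_oc.1.union oM).union oN).union RP_oc.1) RN_oc.1 L3 lRN (by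
    have : (WW ∪ (D ∩ XX AK BK) ∪ (N ∩ XX AK BK) ∪ RP) ∩ RN = (WW ∩ RN) ∪ (D ∩ RN) ∪ (N ∩ RN) := by
      ext p
      constructor
      · rintro ⟨((h | h) | h) | h, h'⟩
        · exact Or.inl (Or.inl ⟨h, h'⟩)
        · exact Or.inl (Or.inr ⟨h.1, h'⟩)
        · exact Or.inr ⟨h.1, h'⟩
        · exact (disjR p h h').elim
      · rintro ((h | h) | h)
        · exact ⟨Or.inl (Or.inl (Or.inl h.1)), h.2⟩
        · exact ⟨Or.inl (Or.inl (Or.inr ⟨h.1, RN_sub h.2⟩)), h.2⟩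
        · exact ⟨Or.inl (Or.inr ⟨h.1, RN_sub h.2⟩), h.2⟩
    rw [this]
    have w1 := mk_W 0 1 (by simp)
    have w2 := mk_W (-8) (-1) (by simp)
    have r1 : ((((0 : ℝ) : ℂ) * I, 100 + ((1 : ℝ) : ℂ) * I) : ℂ × ℂ) ∈ RN := fun k => by
      rw [phiK_im]; have := be_le k; simp; linarith
    have r2 : ((((-8 : ℝ) : ℂ) * I, 100 + ((-1 : ℝ) : ℂ) * I) : ℂ × ℂ) ∈ RN := fun k => by
      rw [phiK_im]; have := be_le k; simp; linarith
    refine three_conn (WW_oc.2.inter RN_oc.2) (cD.inter RN_oc.2) (cnD.inter RN_oc.2)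
      ⟨w1, r1⟩ ⟨?_, r1⟩ ⟨w2, r2⟩ ⟨?_, r2⟩
    · simp [hD, DD]
    · simp [hN, hD, DD]; norm_num)
  have cov : XX AK BK ∩ {q | q.1.im ≠ 0 ∨ q.2.im ≠ 0} ⊆
      WW ∪ (D ∩ XX AK BK) ∪ (N ∩ XX AK BK) ∪ RP ∪ RN := by
    rintro p ⟨hp, hq⟩
    have toRP : (∀ k, 0 < p.1.im - be k * p.2.im) → p ∈ RP := fun h k => by rw [phiK_im]; exact h k
    have toRN : (∀ k, p.1.im - be k * p.2.im < 0) → p ∈ RN := fun h k => by rw [phiK_im]; exact h k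
    rcases lt_trichotomy p.2.im 0 with hy | hy | hy
    · by_cases c1 : 10 * p.2.im < p.1.im
      · by_cases c2 : p.1.im < - p.2.im
        · refine Or.inl (Or.inl (Or.inr ⟨?_, hp⟩))
          simp only [hN, hD, DD, mem_preimage, mem_ofPred_eq, Prod.snd_neg, Prod.fst_neg, neg_im]
          exact ⟨by linarith, by linarith, by linarith⟩
        · refine Or.inl (Or.inr (toRP fun k => ?_))
          have := be_le k
          nlinarith
      · refine Or.inr (toRN fun k => ?_)
        have := be_le k
        nlinarith
    · rcases hq with hq | hq
      · rcases lt_or_gt_of_ne hq with h | h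
        · exact Or.inr (toRN fun k => by rw [hy]; linarith)
        · exact Or.inl (Or.inr (toRP fun k => by rw [hy]; linarith))
      · exact absurd hy hq
    · by_cases c1 : p.1.im < 10 * p.2.im
      · by_cases c2 : - p.2.im < p.1.im
        · refine Or.inl (Or.inl (Or.inl (Or.inr ⟨?_, hp⟩)))
          exact ⟨by linarith, by linarith, by linarith⟩
        · refine Or.inr (toRN fun k => ?_)
          have := be_le k
          nlinarith
      · refine Or.inl (Or.inr (toRP fun k => ?_))
        have := be_le k
        nlinarith
  have LA : LiftsOn x (XX AK BK ∩ {q | q.1.im ≠ 0 ∨ q.2.im ≠ 0}) := by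
    obtain ⟨h, ch, eh⟩ := L4
    exact ⟨h, ch.mono cov, fun p hp => eh p (cov hp)⟩
  have balls : ∀ p ∈ XX AK BK, ∃ r > 0, Metric.ball p r ⊆ XX AK BK := fun p hp =>
    Metric.isOpen_iff.1 oX p hp
  have zero : ∀ p ∈ XX AK BK, p ∉ XX AK BK ∩ {q | q.1.im ≠ 0 ∨ q.2.im ≠ 0} → p.1.im = 0 ∧ p.2.im = 0 := by
    intro p hp hn
    by_contra hcon
    exact hn ⟨hp, by
      simp only [mem_ofPred_eq]; tauto⟩
  refine liftsOn_extend inter_subset_left cx LA ?_ ?_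
  · intro p hp hpA
    obtain ⟨r, hr, hb⟩ := balls p hp
    obtain ⟨z1, z2⟩ := zero p hp hpA
    refine ⟨Metric.ball p r, Metric.isOpen_ball, Metric.mem_ball_self hr, ?_, ?_⟩
    · exact liftsOn_convex Metric.isOpen_ball (convex_ball p r) (cx.mono hb) (fun q hq => nx q (hb hq))
    · rw [← inter_assoc, inter_eq_left.2 hb]
      exact ball_conn p z1 z2 hr
  · intro p hp
    by_cases hpA : p ∈ XX AK BK ∩ {q | q.1.im ≠ 0 ∨ q.2.im ≠ 0}
    · exact subset_closure hpA
    obtain ⟨z1, z2⟩ := zero p hp hpA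
    obtain ⟨r, hr, hb⟩ := balls p hp
    rw [Metric.mem_closure_iff]
    intro d hd
    have hm : 0 < min r d := lt_min hr hd
    have hdist : dist p (p + (((min r d / 2 : ℝ) : ℂ) * I, 0)) = min r d / 2 := by
      rw [dist_eq_norm, sub_add_cancel_left, norm_neg, Prod.norm_def]
      rw [norm_mul, norm_I, mul_one, norm_real, Real.norm_of_nonneg (by linarith), norm_zero]
      exact max_eq_left (by linarith)
    refine ⟨p + (((min r d / 2 : ℝ) : ℂ) * I, 0), ⟨hb ?_, Or.inl ?_⟩, ?_⟩
    · rw [Metric.mem_ball, dist_comm, hdist]; linarith [min_le_left r d]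
    · rw [Prod.fst_add, add_im, z1, zero_add]
      show (((min r d / 2 : ℝ) : ℂ) * I).im ≠ 0
      rw [im_ofReal_mul, I_im, mul_one]
      exact (by linarith : (0:ℝ) < min r d / 2).ne'
    · rw [hdist]; linarith [min_le_right r d]

theorem gen_K {e : ℝ} (he : Eps AK BK e) {x : XX AK BK → ℂ} (cx : Continuous x)
    (nx : ∀ p, x p ≠ 0) : ∃ n : Fin 6 → ℤ, Sim x (fun p => ∏ k, phi AK BK k p ^ n k) := by
  classical
  have ex : ∀ k, ∃ m n, HasDeg (fun p => x (torX AK BK he k p)) m n := fun k =>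
    HasDeg.exists (cx.comp (torX_cont AK BK he k)) (fun p => nx _) ((torX_per AK BK he k).comp x)
  choose m n hmn using ex
  refine ⟨m, ?_⟩
  have cphi : ∀ k, Continuous (fun p : XX AK BK => phi AK BK k p) := fun k =>
    (phi_cont AK BK k).comp continuous_subtype_val
  have cprod : Continuous (fun p : XX AK BK => ∏ k, phi AK BK k p ^ (-m k)) :=
    continuous_finsetProd _ fun k _ => (cphi k).zpow₀ _ (fun p => Or.inl (p.2 k))
  have nprod : ∀ p : XX AK BK, ∏ k, phi AK BK k p ^ (-m k) ≠ 0 := fun p =>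
    Finset.prod_ne_zero_iff.2 fun k _ => zpow_ne_zero _ (p.2 k)
  let y : XX AK BK → ℂ := fun p => x p * ∏ k, phi AK BK k p ^ (-m k)
  have cy : Continuous y := cx.mul cprod
  have ny : ∀ p, y p ≠ 0 := fun p => mul_ne_zero (nx p) (nprod p)
  let x' : ℂ × ℂ → ℂ := fun p => if h : p ∈ XX AK BK then y ⟨p, h⟩ else 1
  have ex' : ∀ p (hp : p ∈ XX AK BK), x' p = y ⟨p, hp⟩ := fun p hp => by simp [x', hp]
  have cx' : ContinuousOn x' (XX AK BK) := by
    rw [continuousOn_iff_continuous_restrict]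
    convert cy using 1
    funext p
    exact ex' p p.2
  obtain ⟨h, ch, eh⟩ := lifts_X cx' (fun p hp => by rw [ex' p hp]; exact ny _) he.1 he.2.1
    (fun k t => by
      obtain ⟨h, ch, eh, h1, -⟩ := (hmn k).mul (deg_tor_prod AK BK he k (fun j => -m j))
      refine ⟨fun s => h (s, t), by fun_prop, fun s => ?_, fun s => ?_⟩
      · have := h1 s t
        simpa using this
      · rw [ex' _ (tor_mem AK BK he k (s, t)), ← eh (s, t)]
        rfl)
  refine ⟨fun p => h p, ?_, fun p => ?_⟩
  · exact continuousOn_iff_continuous_restrict.1 ch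
  · rw [← eh p p.2, ex' p p.2]
    show x p = _ * (x p * _)
    rw [mul_comm (x p), ← mul_assoc, ← Finset.prod_mul_distrib]
    rw [Finset.prod_eq_one, one_mul]
    intro k _
    rw [← zpow_add₀ (p.2 k), add_neg_cancel, zpow_zero]

section
variable {X : Type*} [TopologicalSpace X]

lemma Sim.neg_left (x : X → ℂ) : Sim (fun p => - x p) x :=
  ⟨fun _ => Real.pi * I, continuous_const, fun p => by rw [exp_pi_mul_I]; ring⟩

lemma kap_cont {u : X → ℂ} (cu : Continuous u) (nu : ∀ p, u p ≠ 0) :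
    Continuous (fun p => kap (u p)) := by
  unfold kap
  refine Continuous.if_le continuous_const ?_ (continuous_re.comp cu) continuous_const ?_
  · have : ∀ p, ((‖u p‖ : ℝ) : ℂ) ≠ 0 := fun p => by
      rw [ofReal_ne_zero, norm_ne_zero_iff]; exact nu p
    have c2 : Continuous fun p => ((‖u p‖ : ℝ) : ℂ) := continuous_ofReal.comp cu.norm
    exact ((cu.div c2 this).pow 2).neg
  · intro p hp
    have h1 : u p = (u p).im * I := by
      apply Complex.ext <;> simp [hp]
    have h2 : (u p).im ≠ 0 := fun h => nu p (by rw [h1, h]; simp)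
    have h3 : ((‖u p‖ : ℝ) : ℂ) ^ 2 = ((u p).im : ℂ) ^ 2 := by
      rw [← ofReal_pow, ← normSq_eq_norm_sq, normSq_apply, hp, ← ofReal_pow]; congr 1; ring
    have h4 : ((u p).im : ℂ) ≠ 0 := ofReal_ne_zero.2 h2
    rw [div_pow, h3]
    conv_rhs => rw [h1]
    simp only [mul_pow, I_sq]
    simp
    field_simp

lemma kap_sim {u : X → ℂ} (cu : Continuous u) (nu : ∀ p, u p ≠ 0) :
    Sim (fun p => kap (u p)) u := by
  refine Sim.trans ?_ (Sim.neg_left u)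
  refine Sim.of_slit (kap_cont cu nu) cu.neg (fun p => neg_ne_zero.2 (nu p)) (fun p => ?_)
  have hn : 0 < normSq (u p) := normSq_pos.2 (nu p)
  unfold kap
  split_ifs with h
  · rw [mem_slitPlane_iff, one_div, inv_re, inv_im, normSq_neg]
    rcases lt_or_eq_of_le h with h | h
    · left
      rw [neg_re]; exact div_pos (by linarith) hn
    · right
      have : (u p).im ≠ 0 := fun h' => nu p (Complex.ext h h')
      simp [this, hn.ne']
  · left
    have h3 : ((‖u p‖ : ℝ) : ℂ) ^ 2 = (normSq (u p) : ℂ) := by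
      rw [← ofReal_pow, ← normSq_eq_norm_sq]
    have : -(u p / ‖u p‖) ^ 2 / (-u p) = u p / (normSq (u p) : ℂ) := by
      rw [div_pow, h3]
      have := nu p
      have h5 : (normSq (u p) : ℂ) ≠ 0 := ofReal_ne_zero.2 hn.ne'
      field_simp
    rw [this, div_ofReal_re]
    exact div_pos (not_le.1 h) hn

/-- upper triangular real-linear map -/
def tri (a b c : ℝ) (z : ℂ) : ℂ := ⟨a * z.re + c * z.im, b * z.im⟩

lemma tri_cont (a b c : ℝ) : Continuous (tri a b c) := by
  have : tri a b c = fun z => ((a * z.re + c * z.im : ℝ) : ℂ) + ((b * z.im : ℝ) : ℂ) * I := by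
    funext z; apply Complex.ext <;> simp [tri]
  rw [this]
  fun_prop

lemma tri_sim_pos {a b c : ℝ} (ha : 0 < a) (hb : 0 < b) {x : X → ℂ} (cx : Continuous x)
    (nx : ∀ p, x p ≠ 0) : Sim (fun p => tri a b c (x p)) x := by
  refine Sim.of_slit ((tri_cont a b c).comp cx) cx nx (fun p => ?_)
  by_contra hcon
  rw [mem_slitPlane_iff] at hcon
  push Not at hcon
  obtain ⟨h1, h2⟩ := hcon
  set d := (tri a b c (x p) / x p).re
  have h3 : tri a b c (x p) / x p = (d : ℂ) := Complex.ext rfl (by rw [h2]; simp)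
  rw [div_eq_iff (nx p)] at h3
  have h4 := congrArg im h3
  have h5 := congrArg re h3
  simp [tri] at h4 h5
  have h6 : (x p).im = 0 := by
    rcases h4 with h | h
    · linarith
    · exact h
  have h7 : (x p).re = 0 := by
    rw [h6] at h5
    have : (a - d) * (x p).re = 0 := by linarith
    rcases mul_eq_zero.1 this with h | h
    · linarith
    · exact h
  exact nx p (Complex.ext h7 h6)

lemma tri_sim {a b c : ℝ} (h : 0 < a * b) {x : X → ℂ} (cx : Continuous x)
    (nx : ∀ p, x p ≠ 0) : Sim (fun p => tri a b c (x p)) x := by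
  rcases pos_and_pos_or_neg_and_neg_of_mul_pos h with h | h
  · exact tri_sim_pos h.1 h.2 cx nx
  · have := tri_sim_pos (a := -a) (b := -b) (c := -c) (by linarith) (by linarith) cx nx
    refine Sim.trans ?_ this
    have h2 := Sim.neg_left (fun p => tri (-a) (-b) (-c) (x p))
    convert h2 using 2 with p
    apply Complex.ext <;> simp [tri]; ring

lemma tri_sim' {a b c : ℝ} (h : a * b < 0) {x : X → ℂ} (cx : Continuous x)
    (nx : ∀ p, x p ≠ 0) : Sim (fun p => tri a b c (x p)) (fun p => (x p) ^ (-1 : ℤ)) := by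
  have cc : Continuous (starRingEnd ℂ) := continuous_conj
  have h1 := tri_sim (a := a) (b := -b) (c := -c) (by linarith) (cc.comp cx)
    (fun p => by simpa using nx p)
  have h2 : Sim (fun p => (starRingEnd ℂ) (x p)) (fun p => (x p) ^ (-1 : ℤ)) := by
    refine Sim.of_slit (cc.comp cx) (cx.zpow₀ _ fun p => Or.inl (nx p))
      (fun p => zpow_ne_zero _ (nx p)) (fun p => ?_)
    have : (starRingEnd ℂ) (x p) / (x p) ^ (-1 : ℤ) = (normSq (x p) : ℂ) := by
      rw [zpow_neg_one, div_inv_eq_mul, mul_comm, mul_conj]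
    rw [this]
    exact ofReal_mem_slitPlane.2 (normSq_pos.2 (nx p))
  refine Sim.trans ?_ h2
  refine Sim.trans ?_ h1
  convert Sim.refl _ using 2 with p
  apply Complex.ext <;> simp [tri]

end

def Cls (A B : Fin 6 → ℂ) (F : XX A B → ℂ) (a : Fin 6 → ℤ) : Prop :=
  Sim F (fun p => ∏ k, phi A B k p ^ a k)

section
variable {A B : Fin 6 → ℂ} {F G : XX A B → ℂ} {a b : Fin 6 → ℤ}

lemma Cls.mul (h : Cls A B F a) (h' : Cls A B G b) : Cls A B (fun p => F p * G p) (a + b) := by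
  have := Sim.mul h h'
  unfold Cls
  convert this using 2 with p
  rw [← Finset.prod_mul_distrib]
  exact Finset.prod_congr rfl fun k _ => zpow_add₀ (p.2 k) _ _

lemma Cls.zpow (h : Cls A B F a) (n : ℤ) : Cls A B (fun p => F p ^ n) (n • a) := by
  have := Sim.zpow h n
  unfold Cls
  convert this using 2 with p
  rw [← Finset.prod_zpow]
  refine Finset.prod_congr rfl fun k _ => ?_
  rw [← zpow_mul]; congr 1; simp [mul_comm]

lemma Cls.div (h : Cls A B F a) (h' : Cls A B G b) : Cls A B (fun p => F p / G p) (a - b) := by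
  have := h.mul (h'.zpow (-1))
  simpa [div_eq_mul_inv, sub_eq_add_neg] using this

lemma Cls.sim (h : Cls A B F a) (h' : Sim G F) : Cls A B G a := Sim.trans h' h

lemma Cls.one : Cls A B (fun _ => 1) 0 := by
  unfold Cls
  simpa using Sim.refl _

lemma Cls.prod {ι : Type*} (s : Finset ι) {F : ι → XX A B → ℂ} {a : ι → Fin 6 → ℤ}
    (h : ∀ i, Cls A B (F i) (a i)) : Cls A B (fun p => ∏ i ∈ s, F i p) (∑ i ∈ s, a i) := by
  classical
  induction s using Finset.induction_on with
  | empty => simpa using Cls.one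
  | insert i s hi ih =>
    simp only [Finset.prod_insert hi, Finset.sum_insert hi]
    exact (h i).mul ih

lemma Cls.phi (k : Fin 6) : Cls A B (fun p => phi A B k p) (Pi.single k 1) := by
  unfold Cls
  convert Sim.refl _ using 2 with p
  rw [Finset.prod_eq_single k]
  · simp
  · intro j _ hj; simp [hj]
  · simp

def Pair (A B : Fin 6 → ℂ) (a b : Fin 6 → ℤ) : Prop :=
  ∃ F G : XX A B → ℂ, Continuous F ∧ Continuous G ∧ (∀ p, F p = 1 ∨ G p = 1) ∧
    Cls A B F a ∧ Cls A B G b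

lemma Sim.ne {X : Type*} [TopologicalSpace X] {x y : X → ℂ} (h : Sim x y) {p : X} (hp : y p ≠ 0) :
    x p ≠ 0 := by
  obtain ⟨k, ck, ek⟩ := h
  rw [ek]; exact mul_ne_zero hp (exp_ne_zero _)

lemma Cls.ne (h : Cls A B F a) (p : XX A B) : F p ≠ 0 :=
  Sim.ne h (Finset.prod_ne_zero_iff.2 fun k _ => zpow_ne_zero _ (p.2 k))

lemma Pair.of_sum {F G H : XX A B → ℂ} {a b c : Fin 6 → ℤ} (cF : Continuous F) (cG : Continuous G)
    (cH : Continuous H) (hF : Cls A B F a) (hG : Cls A B G b) (hH : Cls A B H c)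
    (hs : ∀ p, F p + G p = H p) : Pair A B (a - b) (c - b) := by
  have hH' : Cls A B (fun p => - H p) c := hH.sim (Sim.neg_left H)
  refine ⟨fun p => kap (F p / G p), fun p => kap (- H p / G p),
    kap_cont (cF.div cG hG.ne) (fun p => div_ne_zero (hF.ne p) (hG.ne p)),
    kap_cont (cH.neg.div cG hG.ne) (fun p => div_ne_zero (hH'.ne p) (hG.ne p)), fun p => ?_,
    (hF.div hG).sim (kap_sim (cF.div cG hG.ne) (fun p => div_ne_zero (hF.ne p) (hG.ne p))),
    (hH'.div hG).sim (kap_sim (cH.neg.div cG hG.ne) (fun p => div_ne_zero (hH'.ne p) (hG.ne p)))⟩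
  have e1 : F p / G p + - H p / G p = -1 := by
    rw [← hs p]; field_simp [hG.ne p]; ring
  have e2 := congrArg re e1
  simp only [add_re, neg_re, one_re] at e2
  by_cases h : (F p / G p).re ≤ 0
  · left; simp [kap, h]
  · right
    have : (- H p / G p).re ≤ 0 := by linarith
    simp [kap, this]

/-- torus constraint -/
lemma Pair.constraint {e : ℝ} (he : Eps A B e) (h : Pair A B a b) (i : Fin 6) :
    a i * lam A B i b = lam A B i a * b i := by
  obtain ⟨F, G, -, -, hFG, hF, hG⟩ := h
  exact torus (HasDeg.sim hF (torX_cont A B he i) (torX_per A B he i) (deg_tor_prod A B he i a))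
    (HasDeg.sim hG (torX_cont A B he i) (torX_per A B he i) (deg_tor_prod A B he i b))
    (fun p => hFG _)

lemma tri_cls {a b c : ℝ} {s : ℤ} (hs : s = 1 ∨ s = -1) (h : 0 < s * (a * b)) (k : Fin 6) :
    Cls A B (fun p => tri a b c (Maz.phi A B k p)) (s • Pi.single k 1) := by
  have cp : Continuous (fun p : XX A B => Maz.phi A B k p) := (phi_cont A B k).comp continuous_subtype_val
  rcases hs with rfl | rfl
  · rw [one_smul]
    exact (Cls.phi k).sim (tri_sim (by simpa using h) cp (fun p => p.2 k))
  · exact ((Cls.phi k).zpow (-1)).sim (tri_sim' (by simpa using h) cp (fun p => p.2 k))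

end

lemma relK (i j k : Fin 6) {a b c a' b' c' : ℝ} {s : ℤ} (hs : s = 1 ∨ s = -1)
    (h : 0 < s * (a * b)) (h' : 0 < s * (a' * b'))
    (hrel : ∀ p, tri a b c (phi AK BK i p) + tri a' b' c' (phi AK BK j p) = phi AK BK k p) :
    Pair AK BK (s • Pi.single i 1 - s • Pi.single j 1) (Pi.single k 1 - s • Pi.single j 1) := by
  have cp : ∀ k, Continuous (fun p : XX AK BK => phi AK BK k p) := fun k =>
    (phi_cont AK BK k).comp continuous_subtype_val
  exact Pair.of_sum ((tri_cont a b c).comp (cp i)) ((tri_cont a' b' c').comp (cp j)) (cp k)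
    (tri_cls hs h i) (tri_cls hs h' j) (Cls.phi k) (fun p => hrel p)

lemma pair45 (k : Fin 6) (hk : k ≠ 4) (hk' : k ≠ 5) :
    Pair AK BK (Pi.single 4 1 - Pi.single 5 1) (Pi.single k 1 - Pi.single 5 1) := by
  have := relK 4 5 k (a := 7 - al k) (b := 7 - be k) (c := -cc k) (a' := al k - 6) (b' := be k - 6)
    (c' := cc k) (s := 1) (Or.inl rfl)
    (by fin_cases k <;> simp [al, be] at * <;> norm_num)
    (by fin_cases k <;> simp [al, be] at * <;> norm_num)
    (fun p => by
      apply Complex.ext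
      · rw [add_re]
        simp only [tri, phiK_re, phiK_im]
        simp [al, be, cc]; ring
      · rw [add_im]
        simp only [tri, phiK_re, phiK_im]
        simp [be]; ring)
  simpa using this

lemma pair01 (k : Fin 6) (hk : k ≠ 0) (hk' : k ≠ 1) : ∃ s : ℤ,
    (s = 1 ∨ s = -1) ∧
    Pair AK BK (s • Pi.single 0 1 - s • Pi.single 1 1) (Pi.single k 1 - s • Pi.single 1 1) := by
  have hs : ∃ s : ℤ, (s = 1 ∨ s = -1) ∧ 0 < s * ((2 - al k) * (5 - be k)) ∧
      0 < s * ((al k - 1) * (be k - 4)) := by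
    fin_cases k
    · exact absurd rfl hk
    · exact absurd rfl hk'
    · exact ⟨-1, by simp, by simp [al, be]; norm_num, by simp [al, be]; norm_num⟩
    · exact ⟨-1, by simp, by simp [al, be]; norm_num, by simp [al, be]; norm_num⟩
    · exact ⟨1, by simp, by simp [al, be]; norm_num, by simp [al, be]; norm_num⟩
    · exact ⟨1, by simp, by simp [al, be]; norm_num, by simp [al, be]; norm_num⟩
  obtain ⟨s, hs, h1, h2⟩ := hs
  refine ⟨s, hs, relK 0 1 k (c := 5 * (al k - 2) - (cc k - 10)) (c' := -(5 * (al k - 2) - (cc k - 10)))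
    hs h1 h2 (fun p => ?_)⟩
  apply Complex.ext
  · rw [add_re]
    simp only [tri, phiK_re, phiK_im]
    simp [al, be, cc]; ring
  · rw [add_im]
    simp only [tri, phiK_re, phiK_im]
    simp [be]; ring

noncomputable def AL : Fin 6 → ℂ :=
  ![(5 - 5 * I) / 2, (7 - 10 * I) / 2, (5 - 14 * I) / 2, (7 - 9 * I) / 2, 6, (6 - 7 * I) / 2]
noncomputable def BL : Fin 6 → ℂ :=
  ![-((3 - 5 * I) / 2), -((3 - 10 * I) / 2), (3 + 14 * I) / 2, (3 + 9 * I) / 2, 0, (3 + 14 * I) / 2]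

def LK : Fin 6 → Fin 6 → ℤ :=
  ![![-1, 1, -1, -1, 1, -1], ![1, -1, -1, -1, 1, -1], ![-1, -1, -1, 1, 1, 1],
    ![-1, -1, 1, -1, 1, -1], ![1, 1, 1, 1, -1, -1], ![-1, -1, 1, -1, -1, -1]]

/-- twice the real and imaginary parts -/
def dat (v : Fin 6 → ℂ) (r s : Fin 6 → ℤ) : Prop := ∀ i, v i = ⟨(r i : ℝ) / 2, (s i : ℝ) / 2⟩

lemma dat_normSq {v : Fin 6 → ℂ} {r s : Fin 6 → ℤ} (h : dat v r s) (i j : Fin 6) :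
    4 * normSq (v i - v j) = (((r i - r j) ^ 2 + (s i - s j) ^ 2 : ℤ) : ℝ) := by
  rw [h i, h j, normSq_apply]; simp; ring

lemma datAK : dat AK ![5, 7, 5, 7, 12, 14] ![-5, -10, -14, -9, 0, 0] := by
  intro i; fin_cases i <;> apply Complex.ext <;> simp [AK] <;> norm_num
lemma datBK : dat BK ![-3, -3, 3, 3, 0, 0] ![5, 10, 14, 9, 0, 0] := by
  intro i; fin_cases i <;> apply Complex.ext <;> simp [BK] <;> norm_num
lemma datAL : dat AL ![5, 7, 5, 7, 12, 6] ![-5, -10, -14, -9, 0, -7] := by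
  intro i; fin_cases i <;> apply Complex.ext <;> simp [AL] <;> norm_num
lemma datBL : dat BL ![-3, -3, 3, 3, 0, 3] ![5, 10, 14, 9, 0, 14] := by
  intro i; fin_cases i <;> apply Complex.ext <;> simp [BL] <;> norm_num

lemma dat_lt {v u : Fin 6 → ℂ} {r s r' s' : Fin 6 → ℤ} (h : dat v r s) (h' : dat u r' s') (i j : Fin 6) :
    normSq (v i - v j) < normSq (u i - u j) ↔
      (r i - r j) ^ 2 + (s i - s j) ^ 2 < (r' i - r' j) ^ 2 + (s' i - s' j) ^ 2 := by
  rw [← Int.cast_lt (R := ℝ), ← dat_normSq h, ← dat_normSq h']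
  constructor <;> intro h <;> linarith

lemma dat_eq {v u : Fin 6 → ℂ} {r s r' s' : Fin 6 → ℤ} (h : dat v r s) (h' : dat u r' s') (i j : Fin 6) :
    normSq (v i - v j) = normSq (u i - u j) ↔
      (r i - r j) ^ 2 + (s i - s j) ^ 2 = (r' i - r' j) ^ 2 + (s' i - s' j) ^ 2 := by
  rw [← Int.cast_inj (α := ℝ), ← dat_normSq h, ← dat_normSq h']
  constructor <;> intro h <;> linarith

lemma epsK : ∃ e, Eps AK BK e := exists_eps fun i j => by
  rw [Ne, Ne, dat_eq datAK datBK]; revert i j; decide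

lemma epsL : ∃ e, Eps AL BL e := exists_eps fun i j => by
  rw [Ne, Ne, dat_eq datAL datBL]; revert i j; decide

lemma lkL (i j : Fin 6) : lk AL BL i j = LK i j := by
  unfold lk
  rw [if_congr (dat_lt datBL datAL i j) rfl rfl]
  revert i j; decide

lemma minors : ∀ m m' : Fin 6, m ≠ m' → ¬ (m = 0 ∧ m' = 1) → ¬ (m = 1 ∧ m' = 0) →
    ∃ l l', l ≠ m ∧ l ≠ m' ∧ l' ≠ m ∧ l' ≠ m' ∧ LK m l * LK m' l' ≠ LK m l' * LK m' l := by
  decide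

lemma LK_ne : ∀ i j, LK i j ≠ 0 := by decide

lemma two_more : ∀ m : Fin 6, ∃ l l' : Fin 6, l ≠ m ∧ l' ≠ m ∧ l ≠ l' := by decide

def rr (a : Fin 6 → ℤ) (m l : Fin 6) : ℤ :=
  if l = m then -(∑ j, if j = m then 0 else LK m j * a j) else a m * LK m l

lemma fin_alg {a t h : Fin 6 → ℤ} (ha : a ≠ 0) (hr : ∀ m l, rr a m l = t m * h l) :
    a 0 ≠ 0 ∧ a 1 = - a 0 ∧ ∀ k, k ≠ 0 → k ≠ 1 → a k = 0 := by
  have mi : ∀ m m' l l', rr a m l * rr a m' l' = rr a m l' * rr a m' l := by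
    intro m m' l l'; rw [hr, hr, hr, hr]; ring
  have off : ∀ m l, l ≠ m → rr a m l = a m * LK m l := fun m l h => by simp [rr, h]
  have prod0 : ∀ m m' : Fin 6, m ≠ m' → ¬ (m = 0 ∧ m' = 1) → ¬ (m = 1 ∧ m' = 0) → a m * a m' = 0 := by
    intro m m' h1 h2 h3
    obtain ⟨l, l', k1, k2, k3, k4, k5⟩ := minors m m' h1 h2 h3
    have := mi m m' l l'
    rw [off _ _ k1, off _ _ k2, off _ _ k3, off _ _ k4] at this
    have : a m * a m' * (LK m l * LK m' l' - LK m l' * LK m' l) = 0 := by linear_combination this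
    rcases mul_eq_zero.1 this with h | h
    · exact h
    · exact absurd (sub_eq_zero.1 h) k5
  have single : ∀ m, a m ≠ 0 → ∃ m', m' ≠ m ∧ a m' ≠ 0 := by
    intro m hm
    by_contra hcon
    push Not at hcon
    obtain ⟨l, l', h1, h2, h3⟩ := two_more m
    have d : rr a l l = -(LK l m * a m) := by
      simp only [rr, if_true]
      rw [Finset.sum_eq_single m]
      · rw [if_neg h1.symm]
      · intro j _ hj; rw [hcon j hj]; simp
      · simp
    have := mi m l l' l
    rw [off m l' h2, d, off l l' h3.symm, hcon l h1] at this
    have : a m * LK m l' * (LK l m * a m) = 0 := by linear_combination -this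
    simp [hm, LK_ne] at this
  have hout : ∀ k, k ≠ 0 → k ≠ 1 → a k = 0 := by
    intro k h0 h1
    by_contra hk
    obtain ⟨m', h2, h3⟩ := single k hk
    have := prod0 k m' h2.symm (fun h => h0 h.1) (fun h => h1 h.1)
    exact mul_ne_zero hk h3 this
  have h00 : a 0 ≠ 0 := by
    intro h0
    have h1 : a 1 ≠ 0 := by
      intro h1
      apply ha
      funext k
      by_cases k0 : k = 0
      · rw [k0]; exact h0
      by_cases k1 : k = 1
      · rw [k1]; exact h1
      exact hout k k0 k1
    obtain ⟨m', h2, h3⟩ := single 1 h1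
    by_cases h4 : m' = 0
    · exact h3 (h4 ▸ h0)
    · exact h3 (hout m' h4 h2)
  refine ⟨h00, ?_, hout⟩
  have := mi 0 2 3 2
  have d : rr a 2 2 = a 0 + a 1 := by
    simp only [rr, if_true, Fin.sum_univ_six, hout 3 (by decide) (by decide), hout 4 (by decide) (by decide),
      hout 5 (by decide) (by decide)]
    simp [LK]; ring
  rw [d, off 0 3 (by decide), off 2 3 (by decide), hout 2 (by decide) (by decide)] at this
  have h5 : a 0 * (a 0 + a 1) = 0 := by
    have e : LK 0 3 = -1 := by decide
    rw [e] at this; linear_combination -this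
  rcases mul_eq_zero.1 h5 with h | h
  · exact absurd h h00
  · linarith

open Matrix in
lemma twin {N M : Matrix (Fin 6) (Fin 6) ℤ} (hNM : N * M = 1) (hMN : M * N = 1) {e : ℝ} (he : Eps AL BL e)
    (T : ∀ a b, Pair AK BK a b → Pair AL BL (a ᵥ* N) (b ᵥ* N)) (i j : Fin 6) (hij : i ≠ j)
    (H : ∀ k, k ≠ i → k ≠ j → ∃ s : ℤ, (s = 1 ∨ s = -1) ∧
      Pair AK BK (s • Pi.single i 1 - s • Pi.single j 1) (Pi.single k 1 - s • Pi.single j 1))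
    {a : Fin 6 → ℤ} (ha : a = (Pi.single i 1 - Pi.single j 1 : Fin 6 → ℤ) ᵥ* N) :
    a 0 ≠ 0 ∧ a 1 = - a 0 ∧ ∀ k, k ≠ 0 → k ≠ 1 → a k = 0 := by
  have ha0 : a ≠ 0 := by
    rintro rfl
    have := congrArg (fun v => v ᵥ* M) ha
    simp only [vecMul_vecMul, hNM, vecMul_one, zero_vecMul] at this
    have := congrFun this i
    simp [hij] at this
  have rdot : ∀ m (b : Fin 6 → ℤ), (rr a m) ⬝ᵥ b = a m * lam AL BL m b - lam AL BL m a * b m := by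
    intro m b
    simp only [dotProduct, rr, lam, lkL]
    rw [Finset.mul_sum, Finset.sum_mul]
    rw [← Finset.add_sum_erase _ _ (Finset.mem_univ m)]
    rw [← Finset.add_sum_erase _ (fun j => a m * _) (Finset.mem_univ m)]
    simp only [if_true, mul_zero, zero_add, neg_mul, Finset.sum_mul]
    rw [neg_add_eq_sub]
    congr 1
    refine Finset.sum_congr rfl fun l hl => ?_
    rw [if_neg (Finset.ne_of_mem_erase hl), if_neg (Finset.ne_of_mem_erase hl)]
    ring
  have lam_smul : ∀ m (s : ℤ) (b : Fin 6 → ℤ), lam AL BL m (s • b) = s * lam AL BL m b := by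
    intro m s b
    simp only [lam, Finset.mul_sum]
    refine Finset.sum_congr rfl fun l _ => ?_
    split_ifs
    · simp
    · simp; ring
  -- kernel vector
  have key : ∀ k, ∃ s : ℤ, ∀ m, (N *ᵥ rr a m) k = s * (N *ᵥ rr a m) j := by
    intro k
    by_cases hkj : k = j
    · exact ⟨1, fun m => by rw [hkj, one_mul]⟩
    have red : ∀ s : ℤ, (∀ m, rr a m ⬝ᵥ ((Pi.single k 1 - s • Pi.single j 1 : Fin 6 → ℤ) ᵥ* N) = 0) →
        ∀ m, (N *ᵥ rr a m) k = s * (N *ᵥ rr a m) j := by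
      intro s hs m
      have := hs m
      rw [dotProduct_comm, ← dotProduct_mulVec, sub_dotProduct, smul_dotProduct, single_dotProduct,
        single_dotProduct] at this
      simp only [one_mul, smul_eq_mul] at this
      linarith
    by_cases hki : k = i
    · refine ⟨1, red 1 fun m => ?_⟩
      rw [one_smul, hki, ← ha, rdot]; ring
    · obtain ⟨s, hs, hp⟩ := H k hki hkj
      refine ⟨s, red s fun m => ?_⟩
      have h1 := (T _ _ hp).constraint he m
      rw [← smul_sub, smul_vecMul, ← ha, lam_smul] at h1
      rw [rdot]
      simp only [Pi.smul_apply, smul_eq_mul] at h1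
      rcases hs with rfl | rfl
      · linarith
      · linarith
  choose σ hσ using key
  refine fin_alg (t := fun m => (N *ᵥ rr a m) j) (h := M *ᵥ σ) ha0 (fun m l => ?_)
  have e1 : rr a m = M *ᵥ (N *ᵥ rr a m) := by rw [mulVec_mulVec, hMN, one_mulVec]
  have e2 : N *ᵥ rr a m = (N *ᵥ rr a m) j • σ := by
    funext k
    rw [hσ k m]; simp [mul_comm]
  conv_lhs => rw [e1, e2, mulVec_smul]
  simp

open Matrix in
lemma finale {N M : Matrix (Fin 6) (Fin 6) ℤ} (hNM : N * M = 1) (hMN : M * N = 1)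
    (T : ∀ a b, Pair AK BK a b → Pair AL BL (a ᵥ* N) (b ᵥ* N)) : False := by
  obtain ⟨e, he⟩ := epsL
  obtain ⟨h1, h2, h3⟩ := twin hNM hMN he T 4 5 (by decide)
    (fun k h4 h5 => ⟨1, Or.inl rfl, by simpa using pair45 k h4 h5⟩) rfl
  obtain ⟨h1', h2', h3'⟩ := twin hNM hMN he T 0 1 (by decide) pair01 rfl
  set v : Fin 6 → ℤ := Pi.single 4 1 - Pi.single 5 1 with hv
  set v' : Fin 6 → ℤ := Pi.single 0 1 - Pi.single 1 1 with hv'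
  set a := v ᵥ* N with haa
  set a' := v' ᵥ* N with haa'
  have : (a' 0) • a = (a 0) • a' := by
    funext k
    simp only [Pi.smul_apply, smul_eq_mul]
    by_cases k0 : k = 0
    · rw [k0]; ring
    by_cases k1 : k = 1
    · rw [k1, h2, h2']; ring
    rw [h3 k k0 k1, h3' k k0 k1]; ring
  have := congrArg (fun v => v ᵥ* M) this
  simp only [haa, haa', smul_vecMul, vecMul_vecMul, hNM, vecMul_one] at this
  have := congrFun this 4
  simp [hv, hv'] at this
  exact h1' this

set_option maxHeartbeats 2000000 in
open Matrix in
lemma no_equiv (h : ContinuousMap.HomotopyEquiv (XX AK BK) (XX AL BL)) : False := by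
  obtain ⟨e, he⟩ := epsK
  obtain ⟨e', he'⟩ := epsL
  set f := h.toFun with hf
  set g := h.invFun with hg
  have hr : (f.comp g).Homotopic (ContinuousMap.id _) := h.right_inv
  have cL : ∀ j, Continuous (fun p : XX AL BL => phi AL BL j p) :=
    fun j => (phi_cont AL BL j).comp continuous_subtype_val
  have cK : ∀ j, Continuous (fun p : XX AK BK => phi AK BK j p) :=
    fun j => (phi_cont AK BK j).comp continuous_subtype_val
  have ex : ∀ j, ∃ n : Fin 6 → ℤ, Sim (fun p : XX AK BK => phi AL BL j (f p))
      (fun p => ∏ k, phi AK BK k p ^ n k) := fun j =>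
    gen_K he ((cL j).comp f.continuous) (fun p => (f p).2 j)
  choose M hM using ex
  have h1 : ∀ j, Sim (fun q : XX AL BL => phi AL BL j q)
      (fun q => ∏ k, phi AK BK k (g q) ^ M j k) := fun j =>
    (Sim.of_homotopic hr (cL j) (fun p => p.2 j)).symm.trans ((hM j).comp g.continuous)
  have ex2 : ∀ k i, ∃ m n, HasDeg (fun p => phi AK BK k (g (torX AL BL he' i p))) m n :=
    fun k i => HasDeg.exists ((cK k).comp (g.continuous.comp (torX_cont AL BL he' i)))
      (fun p => (g _).2 k) ((torX_per AL BL he' i).comp (fun q => phi AK BK k (g q)))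
  choose N N' hN using ex2
  have hMN : (Matrix.of M) * (Matrix.of N) = 1 := by
    ext j i
    have d1 := HasDeg.prod Finset.univ (fun k => (hN k i).zpow (M j k))
    have d2 := HasDeg.sim (h1 j) (torX_cont AL BL he' i) (torX_per AL BL he' i) d1
    rw [Matrix.mul_apply]
    simp only [Matrix.of_apply]
    by_cases hij : i = j
    · subst hij
      rw [Matrix.one_apply_eq]
      exact (d2.unique (deg_tor_self AL BL he' i)).1
    · rw [Matrix.one_apply_ne (Ne.symm hij)]
      exact (d2.unique (deg_tor_ne AL BL he' i j hij)).1
  have hNM : (Matrix.of N) * (Matrix.of M) = 1 := mul_eq_one_comm.1 hMN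
  have hcl : ∀ k, Cls AL BL (fun q => phi AK BK k (g q)) (N k) := by
    intro k
    have s1 := Sim.prod Finset.univ (fun j => (h1 j).zpow (N k j))
    refine Sim.symm (s1.trans ?_)
    convert Sim.refl _ using 2 with q
    have nz : ∀ l, phi AK BK l (g q) ≠ 0 := fun l => (g q).2 l
    have e1 : ∀ l, ∑ j, N k j * M j l = if k = l then 1 else 0 := by
      intro l
      have := congrFun (congrFun hNM k) l
      rw [Matrix.mul_apply, Matrix.one_apply] at this
      simpa using this
    have zs : ∀ (l : Fin 6) (u : Fin 6 → ℤ), ∏ j, phi AK BK l (g q) ^ u j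
        = phi AK BK l (g q) ^ (∑ j, u j) := by
      intro l u
      simp only [Fin.prod_univ_succ, Fin.sum_univ_succ, zpow_add₀ (nz l)]
      simp
    have : ∏ j, (∏ l, phi AK BK l (g q) ^ M j l) ^ N k j = phi AK BK k (g q) := by
      simp_rw [← Finset.prod_zpow, ← _root_.zpow_mul]
      rw [Finset.prod_comm]
      simp_rw [zs, mul_comm (M _ _), e1]
      simp [Finset.prod_ite_eq, apply_ite]
    exact this.symm
  refine finale (N := Matrix.of N) (M := Matrix.of M) hNM hMN ?_
  have key : ∀ (F : XX AK BK → ℂ) a, Cls AK BK F a →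
      Cls AL BL (fun q => F (g q)) (a ᵥ* Matrix.of N) := by
    intro F a hF
    have s1 : Sim (fun q => F (g q)) (fun q => ∏ k, phi AK BK k (g q) ^ a k) :=
      Sim.comp hF g.continuous
    have s2 := Cls.prod Finset.univ (fun k => (hcl k).zpow (a k))
    have s3 := Cls.sim s2 s1
    convert s3 using 1
    ext i
    simp [Matrix.vecMul, dotProduct]
  rintro a b ⟨F, G, cF, cG, hFG, hF, hG⟩
  exact ⟨fun q => F (g q), fun q => G (g q), cF.comp g.continuous, cG.comp g.continuous,
    fun q => hFG _, key F a hF, key G b hG⟩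

lemma setK : {p : ℂ × ℂ | mazFK p.1 p.2 ≠ 0} = XX AK BK := by
  ext p
  simp only [mem_setOf_eq, XX, mazFK, mazG, mul_ne_zero_iff, Fin.forall_fin_succ, phi, AK, BK]
  simp [and_assoc, sub_eq_add_neg]

lemma setL : {p : ℂ × ℂ | mazFL p.1 p.2 ≠ 0} = XX AL BL := by
  ext p
  simp only [mem_setOf_eq, XX, mazFL, mazG, mul_ne_zero_iff, Fin.forall_fin_succ, phi, AL, BL]
  simp [and_assoc, sub_eq_add_neg]

end Maz

/-- The complements of Mazurovskiĭ's arrangements `K` and `L` are not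
homotopy equivalent. -/
theorem mazurovskii_K_L_not_homotopy_equivalent :
    IsEmpty (ContinuousMap.HomotopyEquiv
      {p : ℂ × ℂ | mazFK p.1 p.2 ≠ 0}
      {p : ℂ × ℂ | mazFL p.1 p.2 ≠ 0}) := by
  rw [Maz.setK, Maz.setL]
  exact ⟨Maz.no_equiv⟩
end
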